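/- arXiv:2008.02019 — 2 statements merged into one kernel-verified Lean document; each statement's English description precedes it below -/
import Mathlib

section
/- Let T be a finite tree with n vertices containing a segment u_1 v_1 v_2 ⋯ v_{s−1} u_2 (of length s ≥ 1) both of whose endpoints u_1 and u_2 are branch vertices, and let u_{1,1}, …, u_{1,t−1} (where t = deg(u_1) ≥ 3) be the neighbors of u_1 other than v_1. Let T′ be the tree obtained from T by deleting the edges u_1 u_{1,1}, …, u_1 u_{1,t−1} and adding the edges u_2 u_{1,1}, …, u_2 u_{1,t−1}. Then T′ is a tree with the same segment sequence as T, and for every integer k with 2 ≤ k ≤ n − s − 1 one has SW_k(T′) < SW_k(T). -/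
open SimpleGraph Finset

/-- The Steiner distance of a finite set `S` of vertices: the minimum number of edges of a
connected subgraph whose vertex set contains `S`. -/
noncomputable def steinerDist {V : Type*} (G : SimpleGraph V) (S : Finset V) : ℕ :=
  sInf {n | ∃ H : G.Subgraph, H.Connected ∧ ↑S ⊆ H.verts ∧ H.edgeSet.ncard = n}

/-- The Steiner `k`-Wiener index: the sum of Steiner distances over all `k`-subsets. -/
noncomputable def steinerWiener {V : Type*} [Fintype V] (G : SimpleGraph V) (k : ℕ) : ℕ :=
  ∑ S ∈ Finset.powersetCard k (Finset.univ : Finset V), steinerDist G S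

/-- Degree of a vertex (as the cardinality of its neighbour set). -/
noncomputable def degN {V : Type*} (G : SimpleGraph V) (v : V) : ℕ := (G.neighborSet v).ncard

/-- A leaf is a vertex of degree 1. -/
def IsLeafV {V : Type*} (G : SimpleGraph V) (v : V) : Prop := degN G v = 1

/-- A branch vertex is a vertex of degree at least 3. -/
def IsBranchV {V : Type*} (G : SimpleGraph V) (v : V) : Prop := 3 ≤ degN G v

/-- `u` and `v` are the endpoints of a segment: a path all of whose internal vertices have
degree 2, whose endpoints are each a leaf or a branch vertex. -/
def IsSegment {V : Type*} (G : SimpleGraph V) (u v : V) : Prop :=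
  u ≠ v ∧ (IsLeafV G u ∨ IsBranchV G u) ∧ (IsLeafV G v ∨ IsBranchV G v) ∧
    ∃ w : G.Walk u v, w.IsPath ∧ ∀ x ∈ w.support, x ≠ u → x ≠ v → degN G x = 2

/-- The multiset of the lengths of all segments of `G` (the segment sequence). -/
noncomputable def segmentMultiset {V : Type*} [Fintype V] (G : SimpleGraph V) : Multiset ℕ :=
  ((Set.toFinite {e : Sym2 V | ∃ u v, e = s(u, v) ∧ IsSegment G u v}).toFinset).val.map
    (Sym2.lift ⟨fun u v => G.dist u v, fun _ _ => SimpleGraph.dist_comm⟩)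

/-- `p` is the parent map of `G` rooted at `r`: every vertex reaches the root by iterating `p`,
and the edges of `G` are exactly the pairs `{x, p x}` with `x ≠ r`. -/
structure IsParentMap {V : Type*} (G : SimpleGraph V) (r : V) (p : V → V) : Prop where
  map_root : p r = r
  reach : ∀ x, ∃ m, p^[m] x = r
  adj_iff : ∀ x y, G.Adj x y ↔ x ≠ y ∧ (p x = y ∨ p y = x)

/-- The set of descendants of `v` (including `v`) with respect to a parent map. -/
def descendants {V : Type*} (p : V → V) (v : V) : Set V := {x | ∃ m, p^[m] x = v}

section ParentMap

variable {V : Type*} {G : SimpleGraph V} {r : V} {p : V → V}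

lemma mem_descendants_self (p : V → V) (v : V) : v ∈ descendants p v := ⟨0, rfl⟩

lemma mem_descendants_of_map {v x : V} (h : p x ∈ descendants p v) : x ∈ descendants p v := by
  obtain ⟨m, hm⟩ := h
  exact ⟨m + 1, hm⟩

lemma mem_descendants_iff {v x : V} :
    x ∈ descendants p v ↔ x = v ∨ p x ∈ descendants p v := by
  constructor
  · rintro ⟨m, hm⟩
    cases m with
    | zero => exact Or.inl hm
    | succ m => exact Or.inr ⟨m, hm⟩
  · rintro (rfl | h)
    · exact mem_descendants_self _ _
    · exact mem_descendants_of_map h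

lemma descendants_trans {u v x : V} (h₁ : x ∈ descendants p v) (h₂ : v ∈ descendants p u) :
    x ∈ descendants p u := by
  obtain ⟨m, rfl⟩ := h₁
  obtain ⟨n, rfl⟩ := h₂
  exact ⟨n + m, Function.iterate_add_apply _ _ _ _⟩

lemma map_mem_descendants_iff {v x : V} (h : x ≠ v) :
    p x ∈ descendants p v ↔ x ∈ descendants p v := by
  rw [mem_descendants_iff (x := x)]
  simp [h]

namespace IsParentMap

lemma iterate_root (h : IsParentMap G r p) (m : ℕ) : p^[m] r = r :=
  Function.iterate_fixed h.map_root m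

lemma eq_root_of_iterate_eq (h : IsParentMap G r p) {x : V} {m : ℕ} (hm : m ≠ 0)
    (hx : p^[m] x = x) : x = r := by
  obtain ⟨n, hn⟩ := h.reach x
  have h1 : p^[m * n] x = x := by
    rw [Function.iterate_mul]; exact Function.iterate_fixed hx n
  obtain ⟨c, hc⟩ : ∃ c, m * n = c + n :=
    ⟨m * n - n, by have := Nat.le_mul_of_pos_left n (Nat.pos_of_ne_zero hm); omega⟩
  rw [hc, Function.iterate_add_apply, hn, h.iterate_root] at h1
  exact h1.symm

lemma descendants_antisymm (h : IsParentMap G r p) {x y : V} (hxy : x ∈ descendants p y)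
    (hyx : y ∈ descendants p x) : x = y := by
  obtain ⟨m, hm⟩ := hxy
  obtain ⟨n, hn⟩ := hyx
  by_cases h0 : n + m = 0
  · obtain rfl : m = 0 := by omega
    exact hm
  · have := h.eq_root_of_iterate_eq h0 (x := x) (by rw [Function.iterate_add_apply, hm, hn])
    subst this
    rw [← hm, h.iterate_root]

lemma map_ne (h : IsParentMap G r p) {x : V} (hx : x ≠ r) : p x ≠ x :=
  fun h' => hx (h.eq_root_of_iterate_eq (m := 1) one_ne_zero h')

lemma map_map_ne (h : IsParentMap G r p) {x : V} (hx : x ≠ r) : p (p x) ≠ x :=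
  fun h' => hx (h.eq_root_of_iterate_eq (m := 2) two_ne_zero h')

lemma adj_map (h : IsParentMap G r p) {x : V} (hx : x ≠ r) : G.Adj x (p x) :=
  (h.adj_iff _ _).2 ⟨(h.map_ne hx).symm, Or.inl rfl⟩

lemma ne_root_of_map_eq (h : IsParentMap G r p) {x y : V} (hy : y ≠ r) (hx : p x = y) :
    x ≠ r := by
  rintro rfl
  exact hy (hx ▸ h.map_root)

lemma injOn_parent_edge (h : IsParentMap G r p) :
    Set.InjOn (fun v => s(v, p v)) {v | v ≠ r} := by
  intro x hx y hy hxy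
  rcases Sym2.eq_iff.1 hxy with h1 | h1
  · exact h1.1
  · exact absurd (h1.1 ▸ h1.2 : p (p y) = y) (h.map_map_ne hy)

lemma edgeSet_eq (h : IsParentMap G r p) :
    G.edgeSet = (fun v => s(v, p v)) '' {v | v ≠ r} := by
  ext e
  induction e with
  | h x y =>
    simp only [mem_edgeSet, h.adj_iff, Set.mem_image, Set.mem_ofPred_eq, Sym2.eq_iff]
    constructor
    · rintro ⟨hne, h1 | h1⟩
      · refine ⟨x, ?_, Or.inl ⟨rfl, h1⟩⟩
        rintro rfl
        exact hne (h.map_root.symm.trans h1)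
      · refine ⟨y, ?_, Or.inr ⟨rfl, h1⟩⟩
        rintro rfl
        exact hne (h1.symm.trans h.map_root)
    · rintro ⟨v, hv, ⟨rfl, rfl⟩ | ⟨rfl, rfl⟩⟩
      · exact ⟨(h.map_ne hv).symm, Or.inl rfl⟩
      · exact ⟨h.map_ne hv, Or.inr rfl⟩

lemma reachable_iterate (h : IsParentMap G r p) (m : ℕ) (x : V) :
    G.Reachable x (p^[m] x) := by
  induction m generalizing x with
  | zero => exact Reachable.refl _
  | succ m ih =>
    by_cases hx : x = r
    · subst hx
      rw [h.iterate_root]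
    · exact (h.adj_map hx).reachable.trans (ih (p x))

lemma isTree [Finite V] (h : IsParentMap G r p) : G.IsTree := by
  rw [isTree_iff_connected_and_card]
  have hr : ∀ x, G.Reachable x r := fun x => by
    obtain ⟨m, hm⟩ := h.reach x
    exact hm ▸ h.reachable_iterate m x
  have : Nonempty V := ⟨r⟩
  refine ⟨⟨fun x y => (hr x).trans (hr y).symm⟩, ?_⟩
  have := Set.ncard_add_ncard_compl ({r} : Set V)
  rw [Set.ncard_singleton] at this
  rw [h.edgeSet_eq, Nat.card_coe_set_eq, h.injOn_parent_edge.ncard_image, ← this, add_comm]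
  rfl

end IsParentMap

/-- Every tree has a parent map towards any chosen root. -/
lemma exists_isParentMap (hG : G.IsTree) (r : V) : ∃ p : V → V, IsParentMap G r p := by
  classical
  choose f hf hf' using (hG.existsUnique_path · r)
  have hroot : (f r).snd = r := by
    rw [← hf' r Walk.nil Walk.IsPath.nil]; rfl
  have hadj : ∀ x y, G.Adj x y → (f x).snd = y ∨ (f y).snd = x := by
    intro x y hxy
    by_cases hy : y ∈ (f x).support
    · left
      have h1 : (f x).takeUntil y hy = hxy.toWalk :=
        (hG.existsUnique_path x y).unique ((hf x).takeUntil hy) (Walk.IsPath.of_adj hxy)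
      rw [← (f x).take_spec hy, h1, Adj.toWalk, Walk.cons_append, Walk.snd_cons]
    · right
      rw [← hf' y (Walk.cons hxy.symm (f x)) ((hf x).cons hy), Walk.snd_cons]
  refine ⟨fun x => (f x).snd, hroot, ?_, fun x y => ⟨fun h => ⟨h.ne, hadj x y h⟩, ?_⟩⟩
  · have key : ∀ n x, (f x).length ≤ n → ∃ m, (fun x => (f x).snd)^[m] x = r := by
      intro n
      induction n with
      | zero => exact fun x hx => ⟨0, Walk.eq_of_length_eq_zero (Nat.le_zero.1 hx)⟩
      | succ n ih =>
        intro x hx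
        by_cases hnil : (f x).Nil
        · exact ⟨0, hnil.eq⟩
        · have h1 : (f x).tail = f (f x).snd := hf' _ _ (hf x).tail
          obtain ⟨m, hm⟩ := ih (f x).snd (by
            rw [← h1]; have := Walk.length_tail_add_one hnil; omega)
          exact ⟨m + 1, hm⟩
    exact fun x => key _ x le_rfl
  · have key : ∀ x, (f x).snd ≠ x → G.Adj x (f x).snd := by
      intro x hx
      refine (f x).adj_snd fun hnil => hx ?_
      have := hnil.eq
      subst this
      exact hroot
    rintro ⟨hne, rfl | rfl⟩
    · exact key x hne.symm
    · exact (key y hne).symm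

end ParentMap

section SteinerDistance

variable {V : Type*} {G : SimpleGraph V} {r : V} {p : V → V}

/-- `D` separates `S` if `S` meets both `D` and its complement. -/
def Separates (D : Set V) (S : Finset V) : Prop := (∃ x ∈ S, x ∈ D) ∧ ∃ x ∈ S, x ∉ D

lemma IsParentMap.parent_edge_mem_of_separates (h : IsParentMap G r p) {S : Finset V}
    {H : G.Subgraph} (hH : H.Connected) (hS : ↑S ⊆ H.verts) {v : V}
    (hv : Separates (descendants p v) S) : s(v, p v) ∈ H.edgeSet := by
  obtain ⟨⟨x, hxS, hx⟩, y, hyS, hy⟩ := hv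
  obtain ⟨q⟩ := hH.coe.preconnected ⟨x, hS hxS⟩ ⟨y, hS hyS⟩
  obtain ⟨d, -, hd1, hd2⟩ :=
    q.exists_boundary_dart (Subtype.val ⁻¹' descendants p v) hx hy
  have hd := d.adj
  rw [Subgraph.coe_adj] at hd
  obtain ⟨hne, h1 | h1⟩ := (h.adj_iff _ _).1 hd.adj_sub
  · by_cases hdv : (d.fst : V) = v
    · rw [hdv] at h1 hd
      rw [h1]
      exact hd
    · exact absurd (show (d.snd : V) ∈ descendants p v from
        h1 ▸ (map_mem_descendants_iff hdv).2 hd1) hd2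
  · exact absurd (mem_descendants_of_map (h1.symm ▸ hd1)) hd2

lemma IsParentMap.exists_subgraph_separates [Finite V] (h : IsParentMap G r p) {S : Finset V}
    (hS : S.Nonempty) : ∃ H : G.Subgraph, H.Connected ∧ ↑S ⊆ H.verts ∧
      H.edgeSet ⊆ (fun v => s(v, p v)) '' {v | v ≠ r ∧ Separates (descendants p v) S} := by
  obtain ⟨t, ht, hmin⟩ := Set.exists_min_image {t | ∀ x ∈ S, x ∈ descendants p t}
    (fun t => (descendants p t).ncard) (Set.toFinite _) ⟨r, fun x _ => h.reach x⟩
  set W : Set V := {v | (∃ x ∈ S, x ∈ descendants p v) ∧ v ∈ descendants p t} with hW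
  have htW : t ∈ W := by
    obtain ⟨x, hx⟩ := hS
    exact ⟨⟨x, hx, ht x hx⟩, mem_descendants_self _ _⟩
  refine ⟨(⊤ : G.Subgraph).induce W, ?_, ?_, ?_⟩
  · rw [← connected_induce_iff]
    have key : ∀ m, ∀ v (hv : v ∈ W), p^[m] v = t →
        (G.induce W).Reachable ⟨v, hv⟩ ⟨t, htW⟩ := by
      intro m
      induction m with
      | zero =>
        rintro v hv rfl
        exact Reachable.refl _
      | succ m ih =>
        intro v hv hm
        by_cases hvt : v = t
        · subst hvt
          exact Reachable.refl _
        · have hvr : v ≠ r := by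
            rintro rfl
            exact hvt (by rw [← hm, h.iterate_root])
          have hpW : p v ∈ W := by
            obtain ⟨⟨x, hxS, hx⟩, hvt'⟩ := hv
            exact ⟨⟨x, hxS, descendants_trans hx ⟨1, rfl⟩⟩, (map_mem_descendants_iff hvt).2 hvt'⟩
          exact Reachable.trans (Adj.reachable (show (G.induce W).Adj ⟨v, hv⟩ ⟨p v, hpW⟩ from
            h.adj_map hvr)) (ih (p v) hpW hm)
    have hr : ∀ v : W, (G.induce W).Reachable v ⟨t, htW⟩ := fun v => by
      obtain ⟨m, hm⟩ := v.2.2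
      exact key m v v.2 hm
    have : Nonempty W := ⟨⟨t, htW⟩⟩
    exact ⟨fun x y => (hr x).trans (hr y).symm⟩
  · intro x hx
    exact ⟨⟨x, hx, mem_descendants_self _ _⟩, ht x hx⟩
  · have hsep : ∀ v, v ≠ r → v ∈ W → p v ∈ W → Separates (descendants p v) S := by
      intro v hvr hv hpv
      refine ⟨hv.1, ?_⟩
      by_contra! hcon
      have hvt : v ≠ t := by
        rintro rfl
        exact h.map_ne hvr (h.descendants_antisymm hpv.2 ⟨1, rfl⟩)
      refine absurd (hmin v hcon) (not_le.2 (Set.ncard_lt_ncard ⟨?_, ?_⟩))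
      · exact fun x hx => descendants_trans hx hv.2
      · exact fun hle => hvt (h.descendants_antisymm hv.2 (hle (mem_descendants_self _ _)))
    intro e he
    have heG := Subgraph.edgeSet_subset _ he
    rw [h.edgeSet_eq] at heG
    obtain ⟨v, hv, rfl⟩ := heG
    obtain ⟨h1, h2, -⟩ := he
    exact ⟨v, ⟨hv, hsep v hv h1 h2⟩, rfl⟩

/-- The Steiner distance counts the edges whose removal separates the given set. -/
lemma IsParentMap.steinerDist_eq [Finite V] (h : IsParentMap G r p) {S : Finset V}
    (hS : S.Nonempty) :
    steinerDist G S = {v | v ≠ r ∧ Separates (descendants p v) S}.ncard := by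
  have hinj : Set.InjOn (fun v => s(v, p v)) {v | v ≠ r ∧ Separates (descendants p v) S} :=
    h.injOn_parent_edge.mono fun v hv => hv.1
  have hlow : ∀ H : G.Subgraph, H.Connected → ↑S ⊆ H.verts →
      (fun v => s(v, p v)) '' {v | v ≠ r ∧ Separates (descendants p v) S} ⊆ H.edgeSet := by
    rintro H hH hSH _ ⟨v, hv, rfl⟩
    exact h.parent_edge_mem_of_separates hH hSH hv.2
  obtain ⟨H, hH, hSH, hE⟩ := h.exists_subgraph_separates hS
  rw [← hinj.ncard_image]
  refine le_antisymm (Nat.sInf_le ⟨H, hH, hSH, ?_⟩) (le_csInf ⟨_, H, hH, hSH, rfl⟩ ?_)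
  · rw [hE.antisymm (hlow H hH hSH)]
  · rintro _ ⟨H', hH', hSH', rfl⟩
    exact Set.ncard_le_ncard (hlow H' hH' hSH') (Set.toFinite _)

open Classical in
lemma IsParentMap.steinerWiener_eq [Fintype V] (h : IsParentMap G r p) {k : ℕ} (hk : k ≠ 0) :
    steinerWiener G k = ∑ v ∈ univ.erase r,
      #{S ∈ powersetCard k (univ : Finset V) | Separates (descendants p v) S} := by
  simp only [steinerWiener, card_filter]
  rw [sum_comm]
  refine sum_congr rfl fun S hS => ?_
  have hS : S.Nonempty := by
    rw [← card_pos, (mem_powersetCard.1 hS).2]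
    omega
  rw [h.steinerDist_eq hS, ← card_filter, ← Set.ncard_coe_finset]
  congr 1
  ext v
  simp

open Classical in
lemma card_separates_add [Fintype V] (D : Set V) {k : ℕ} (hk : k ≠ 0) :
    #{S ∈ powersetCard k (univ : Finset V) | Separates D S} +
      (D.ncard.choose k + (Fintype.card V - D.ncard).choose k) = (Fintype.card V).choose k := by
  have h1 : D.ncard = #D.toFinset := Set.ncard_eq_toFinset_card' D
  have h2 : Fintype.card V - D.ncard = #D.toFinsetᶜ := by rw [card_compl, h1]
  have hdisj : Disjoint (powersetCard k D.toFinset) (powersetCard k D.toFinsetᶜ) := by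
    rw [Finset.disjoint_left]
    intro S hS hS'
    rw [mem_powersetCard] at hS hS'
    obtain ⟨x, hx⟩ : S.Nonempty := by
      rw [← card_pos]
      omega
    exact (mem_compl.1 (hS'.1 hx)) (hS.1 hx)
  rw [h2, h1, ← card_powersetCard, ← card_powersetCard, ← card_union_of_disjoint hdisj,
    ← Finset.card_univ, ← card_powersetCard k (univ : Finset V),
    ← card_filter_add_card_filter_not (s := powersetCard k univ) (Separates D)]
  congr 2
  ext S
  simp only [mem_union, mem_powersetCard, Separates,
    Finset.subset_iff, mem_compl, Set.mem_toFinset]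
  grind

end SteinerDistance

section Segments

variable {V : Type*} {G : SimpleGraph V} {r : V} {p : V → V}

/-- `IsClimb G p v m` says that the `m`-th ancestor of `v` is the first proper ancestor of `v`
whose degree is not `2`. -/
def IsClimb (G : SimpleGraph V) (p : V → V) (v : V) (m : ℕ) : Prop :=
  1 ≤ m ∧ degN G (p^[m] v) ≠ 2 ∧ ∀ i, 1 ≤ i → i < m → degN G (p^[i] v) = 2

lemma IsClimb.unique {v : V} {m n : ℕ} (hm : IsClimb G p v m) (hn : IsClimb G p v n) :
    m = n := by
  rcases lt_trichotomy m n with hlt | rfl | hlt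
  · exact absurd (hn.2.2 m hm.1 hlt) hm.2.1
  · rfl
  · exact absurd (hm.2.2 n hn.1 hlt) hn.2.1

lemma neighborSet_eq_insert (h : IsParentMap G r p) {x : V} (hx : x ≠ r) :
    G.neighborSet x = insert (p x) {y | p y = x} := by
  ext y
  simp only [mem_neighborSet, h.adj_iff, Set.mem_insert_iff, Set.mem_ofPred_eq]
  constructor
  · rintro ⟨-, h1 | h1⟩
    · exact Or.inl h1.symm
    · exact Or.inr h1
  · rintro (rfl | rfl)
    · exact ⟨(h.map_ne hx).symm, Or.inl rfl⟩
    · exact ⟨h.map_ne (h.ne_root_of_map_eq hx rfl), Or.inr rfl⟩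

lemma IsParentMap.degN_eq [Finite V] (h : IsParentMap G r p) {x : V} (hx : x ≠ r) :
    degN G x = {y | p y = x}.ncard + 1 := by
  rw [degN, neighborSet_eq_insert h hx, Set.ncard_insert_of_notMem]
  exact h.map_map_ne hx

lemma IsParentMap.eq_of_map_eq [Finite V] (h : IsParentMap G r p) {x a b : V} (hx : x ≠ r)
    (hd : degN G x = 2) (ha : p a = x) (hb : p b = x) : a = b := by
  have h1 : {y | p y = x}.ncard = 1 := by
    have := h.degN_eq hx
    omega
  exact (Set.ncard_le_one_iff (Set.toFinite _)).1 h1.le ha hb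

lemma IsParentMap.exists_climb (h : IsParentMap G r p) (hr : degN G r ≠ 2) {v : V}
    (hv : v ≠ r) : ∃ m, IsClimb G p v m := by
  classical
  have hex : ∃ m, 1 ≤ m ∧ degN G (p^[m] v) ≠ 2 := by
    obtain ⟨m, hm⟩ := h.reach v
    refine ⟨m, ?_, hm ▸ hr⟩
    by_contra! h0
    obtain rfl : m = 0 := by omega
    exact hv hm
  refine ⟨Nat.find hex, (Nat.find_spec hex).1, (Nat.find_spec hex).2, fun i hi hlt => ?_⟩
  by_contra hne
  exact Nat.find_min hex hlt ⟨hi, hne⟩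

lemma IsParentMap.exists_path_iterate (h : IsParentMap G r p) (m : ℕ) (v : V)
    (hv : ∀ i < m, p^[i] v ≠ r) : ∃ w : G.Walk v (p^[m] v), w.IsPath ∧ w.length = m ∧
      ∀ x ∈ w.support, ∃ i ≤ m, x = p^[i] v := by
  induction m generalizing v with
  | zero => exact ⟨Walk.nil, Walk.IsPath.nil, rfl, fun x hx => ⟨0, le_rfl, by simpa using hx⟩⟩
  | succ m ih =>
    obtain ⟨w, hw, hl, hs⟩ := ih (p v) fun i hi => hv (i + 1) (by omega)
    have hvr : v ≠ r := hv 0 (by omega)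
    rw [Function.iterate_succ_apply]
    refine ⟨Walk.cons (h.adj_map hvr) w, hw.cons fun hmem => ?_, by simp [hl], ?_⟩
    · obtain ⟨i, -, hi⟩ := hs v hmem
      exact hvr (h.eq_root_of_iterate_eq i.succ_ne_zero hi.symm)
    · intro x hx
      rw [Walk.support_cons, List.mem_cons] at hx
      rcases hx with rfl | hx
      · exact ⟨0, by omega, rfl⟩
      · obtain ⟨i, hi, rfl⟩ := hs x hx
        exact ⟨i + 1, by omega, rfl⟩

lemma IsClimb.iterate_ne_root (hr : degN G r ≠ 2) {v : V} (hv : v ≠ r) {m : ℕ}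
    (hm : IsClimb G p v m) : ∀ i < m, p^[i] v ≠ r := by
  intro i hi heq
  rcases Nat.eq_zero_or_pos i with rfl | hpos
  · exact hv heq
  · exact hr (heq ▸ hm.2.2 i hpos hi)

lemma IsParentMap.dist_climb [Finite V] (h : IsParentMap G r p) (hr : degN G r ≠ 2) {v : V}
    (hv : v ≠ r) {m : ℕ} (hm : IsClimb G p v m) : G.dist v (p^[m] v) = m := by
  obtain ⟨w, hw, hl, -⟩ := h.exists_path_iterate m v (hm.iterate_ne_root hr hv)
  obtain ⟨q, hq, hql⟩ := h.isTree.connected.exists_path_of_dist v (p^[m] v)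
  rw [← hql, (h.isTree.existsUnique_path _ _).unique hq hw, hl]

lemma IsParentMap.isSegment_climb (h : IsParentMap G r p) (hr : degN G r ≠ 2)
    (hlb : ∀ v, degN G v ≠ 2 → IsLeafV G v ∨ IsBranchV G v) {v : V}
    (hv : v ≠ r) (hd : degN G v ≠ 2) {m : ℕ} (hm : IsClimb G p v m) :
    IsSegment G v (p^[m] v) := by
  obtain ⟨w, hw, hl, hs⟩ := h.exists_path_iterate m v (hm.iterate_ne_root hr hv)
  refine ⟨fun heq => hv (h.eq_root_of_iterate_eq (by have := hm.1; omega) heq.symm),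
    hlb _ hd, hlb _ hm.2.1, w, hw, fun x hx hxv hxm => ?_⟩
  obtain ⟨i, hi, rfl⟩ := hs x hx
  refine hm.2.2 i (Nat.pos_of_ne_zero ?_) (lt_of_le_of_ne hi ?_)
  · rintro rfl
    exact hxv rfl
  · rintro rfl
    exact hxm rfl

lemma IsParentMap.isClimb_of_path [Finite V] (h : IsParentMap G r p) (hr : degN G r ≠ 2)
    {u v : V} (w : G.Walk u v) (hw : w.IsPath)
    (hinner : ∀ x ∈ w.support, x ≠ u → x ≠ v → degN G x = 2) (hv : degN G v ≠ 2)
    (hnil : ¬ w.Nil) (hup : p u = w.snd) : ∃ m, IsClimb G p u m ∧ p^[m] u = v := by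
  induction w with
  | nil => exact absurd Walk.Nil.nil hnil
  | @cons u y v hadj q ih =>
    rw [Walk.snd_cons] at hup
    subst hup
    rw [Walk.cons_isPath_iff] at hw
    by_cases hq : q.Nil
    · have := hq.eq
      subst this
      exact ⟨1, ⟨le_rfl, hv, fun i h1 h2 => by omega⟩, rfl⟩
    · have hne : p u ≠ v := fun heq => by
        subst heq
        exact hq (Walk.isPath_iff_nil.1 hw.1)
      have hd : degN G (p u) = 2 := hinner _ (by simp) hadj.ne' hne
      have hpr : p u ≠ r := fun heq => hr (heq ▸ hd)
      have hsnd : p (p u) = q.snd := by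
        obtain ⟨-, h1 | h1⟩ := (h.adj_iff _ _).1 (q.adj_snd hq)
        · exact h1
        · have hmem : q.snd ∈ q.support := q.getVert_mem_support 1
          rw [← h.eq_of_map_eq hpr hd rfl h1] at hmem
          exact absurd hmem hw.2
      obtain ⟨m, hm, hmv⟩ := ih hw.1 (fun x hx hxp hxv => hinner x (by simp [hx])
        (fun hxu => hw.2 (hxu ▸ hx)) hxv) hv hq hsnd
      refine ⟨m + 1, ⟨by omega, hm.2.1, fun i h1 h2 => ?_⟩, hmv⟩
      obtain ⟨j, rfl⟩ : ∃ j, i = j + 1 := ⟨i - 1, by omega⟩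
      rw [Function.iterate_succ_apply]
      rcases Nat.eq_zero_or_pos j with rfl | hj
      · exact hd
      · exact hm.2.2 j hj (by omega)

lemma IsParentMap.map_eq_penultimate (h : IsParentMap G r p) {u v : V} (w : G.Walk u v)
    (hw : w.IsPath) (hnil : ¬ w.Nil) (hdown : p w.snd = u) : p v = w.penultimate := by
  induction w with
  | nil => exact absurd Walk.Nil.nil hnil
  | @cons u y v hadj q ih =>
    rw [Walk.snd_cons] at hdown
    rw [Walk.cons_isPath_iff] at hw
    by_cases hq : q.Nil
    · cases hq
      exact hdown
    · rw [Walk.penultimate_cons_of_not_nil _ _ hq]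
      refine ih hw.1 hq ?_
      obtain ⟨-, h1 | h1⟩ := (h.adj_iff _ _).1 (q.adj_snd hq)
      · have hu : q.snd ∈ q.support := q.getVert_mem_support 1
        rw [← h1, hdown] at hu
        exact absurd hu hw.2
      · exact h1

lemma IsSegment.symm {u v : V} (h : IsSegment G u v) : IsSegment G v u := by
  obtain ⟨hne, hu, hv, w, hw, hinner⟩ := h
  refine ⟨hne.symm, hv, hu, w.reverse, hw.reverse, fun x hx hxv hxu => hinner x ?_ hxu hxv⟩
  simpa using hx

lemma degN_ne_two_of_isLeafV_or_isBranchV {v : V} (h : IsLeafV G v ∨ IsBranchV G v) :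
    degN G v ≠ 2 := by
  unfold IsLeafV IsBranchV at h
  omega

/-- In a rooted tree one end of a segment is the first ancestor of degree `≠ 2` of the other. -/
lemma IsParentMap.exists_climb_of_isSegment [Finite V] (h : IsParentMap G r p)
    (hr : degN G r ≠ 2) {u v : V} (hs : IsSegment G u v) :
    (∃ m, IsClimb G p u m ∧ p^[m] u = v) ∨ ∃ m, IsClimb G p v m ∧ p^[m] v = u := by
  obtain ⟨hne, hu, hv, w, hw, hinner⟩ := hs
  have hnil : ¬ w.Nil := fun hn => hne hn.eq
  obtain ⟨-, h1 | h1⟩ := (h.adj_iff _ _).1 (w.adj_snd hnil)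
  · exact Or.inl (h.isClimb_of_path hr w hw hinner (degN_ne_two_of_isLeafV_or_isBranchV hv) hnil h1)
  · refine Or.inr (h.isClimb_of_path hr w.reverse hw.reverse (fun x hx hxv hxu => hinner x ?_ hxu hxv)
      (degN_ne_two_of_isLeafV_or_isBranchV hu) ?_ ?_)
    · simpa using hx
    · simpa using hnil
    · rw [Walk.snd_reverse]
      exact h.map_eq_penultimate w hw hnil h1

open Classical in
/-- The segment sequence of a rooted tree is indexed by the non-root vertices of degree `≠ 2`. -/
lemma IsParentMap.segmentMultiset_eq [Fintype V] (h : IsParentMap G r p) (hr : degN G r ≠ 2)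
    (hlb : ∀ v, degN G v ≠ 2 → IsLeafV G v ∨ IsBranchV G v) (c : V → ℕ)
    (hc : ∀ v, v ≠ r → IsClimb G p v (c v)) :
    segmentMultiset G = ({v | v ≠ r ∧ degN G v ≠ 2} : Finset V).val.map c := by
  have hinj : Set.InjOn (fun v => s(v, p^[c v] v))
      ({v | v ≠ r ∧ degN G v ≠ 2} : Finset V) := by
    intro a ha b hb hab
    simp only [coe_filter, mem_univ, true_and, Set.mem_ofPred_eq] at ha hb
    rcases Sym2.eq_iff.1 hab with h1 | h1
    · exact h1.1
    · exact h.descendants_antisymm ⟨c a, h1.2⟩ ⟨c b, h1.1.symm⟩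
  have himg : (Set.toFinite {e : Sym2 V | ∃ u v, e = s(u, v) ∧ IsSegment G u v}).toFinset =
      ({v | v ≠ r ∧ degN G v ≠ 2} : Finset V).image fun v => s(v, p^[c v] v) := by
    have key : ∀ u v, IsSegment G u v → ∀ m, IsClimb G p u m → p^[m] u = v →
        u ≠ r ∧ degN G u ≠ 2 ∧ p^[c u] u = v := by
      rintro u v hs m hm rfl
      have hur : u ≠ r := by
        rintro rfl
        exact hs.1 (h.iterate_root m).symm
      exact ⟨hur, degN_ne_two_of_isLeafV_or_isBranchV hs.2.1, by rw [(hc u hur).unique hm]⟩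
    ext e
    simp only [Set.Finite.mem_toFinset, Set.mem_ofPred_eq, mem_image, mem_filter, mem_univ,
      true_and]
    constructor
    · rintro ⟨u, v, rfl, hs⟩
      rcases h.exists_climb_of_isSegment hr hs with ⟨m, hm, hmv⟩ | ⟨m, hm, hmv⟩
      · obtain ⟨h1, h2, h3⟩ := key u v hs m hm hmv
        exact ⟨u, ⟨h1, h2⟩, by rw [h3]⟩
      · obtain ⟨h1, h2, h3⟩ := key v u hs.symm m hm hmv
        exact ⟨v, ⟨h1, h2⟩, by rw [h3, Sym2.eq_swap]⟩
    · rintro ⟨v, ⟨hv, hd⟩, rfl⟩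
      exact ⟨_, _, rfl, h.isSegment_climb hr hlb hv hd (hc v hv)⟩
  rw [segmentMultiset, himg, image_val_of_injOn hinj, Multiset.map_map]
  refine Multiset.map_congr rfl fun v hv => ?_
  have hv' : v ≠ r := by
    have : v ∈ ({v | v ≠ r ∧ degN G v ≠ 2} : Finset V) := hv
    exact (mem_filter.1 this).2.1
  simpa using h.dist_climb hr hv' (hc v hv')

lemma IsParentMap.isLeafV_or_isBranchV [Finite V] (h : IsParentMap G r p) (hr : IsBranchV G r)
    {v : V} (hv : degN G v ≠ 2) : IsLeafV G v ∨ IsBranchV G v := by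
  by_cases hvr : v = r
  · exact Or.inr (hvr ▸ hr)
  · have := h.degN_eq hvr
    unfold IsLeafV IsBranchV
    omega

end Segments

section Reattach

variable {V : Type*} {G G' : SimpleGraph V} {r u : V} {p : V → V}

open Classical in
/-- The parent map obtained from `p` by making all children of `u` children of `r`. -/
noncomputable def reattach (p : V → V) (u r : V) (x : V) : V := if p x = u then r else p x

lemma reattach_of_eq {x : V} (h : p x = u) : reattach p u r x = r := if_pos h

lemma reattach_of_ne {x : V} (h : p x ≠ u) : reattach p u r x = p x := if_neg h

lemma reattach_eq_iff {x y : V} (hyr : y ≠ r) : reattach p u r x = y ↔ p x = y ∧ y ≠ u := by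
  by_cases hx : p x = u
  · rw [reattach_of_eq hx, hx]
    exact ⟨fun h => absurd h.symm hyr, fun h => absurd h.1.symm h.2⟩
  · rw [reattach_of_ne hx]
    exact ⟨fun h => ⟨h, h ▸ hx⟩, fun h => h.1⟩

lemma IsParentMap.reattach (h : IsParentMap G r p) (hu : u ≠ r)
    (hG' : ∀ x y, G'.Adj x y ↔ (G.Adj x y ∧ ¬ ∃ z, p z = u ∧ s(x, y) = s(u, z)) ∨
      ((∃ z, p z = u ∧ s(x, y) = s(r, z)) ∧ x ≠ y)) :
    IsParentMap G' r (reattach p u r) := by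
  have hroot : _root_.reattach p u r r = r := by
    rw [reattach_of_ne (by rw [h.map_root]; exact hu.symm), h.map_root]
  refine ⟨hroot, fun x => ?_, fun x y => ?_⟩
  · obtain ⟨m, hm⟩ := h.reach x
    induction m generalizing x with
    | zero => exact ⟨0, hm⟩
    | succ m ih =>
      by_cases hx : p x = u
      · exact ⟨1, reattach_of_eq hx⟩
      · obtain ⟨n, hn⟩ := ih (p x) hm
        exact ⟨n + 1, by rw [Function.iterate_succ_apply, reattach_of_ne hx, hn]⟩
  · have huu : p u ≠ u := h.map_ne hu
    have hpp : p (p u) ≠ u := h.map_map_ne hu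
    have hrr := h.map_root
    rw [hG', h.adj_iff]
    simp only [Sym2.eq_iff]
    unfold _root_.reattach
    grind

lemma IsParentMap.reattach_iterate (h : IsParentMap G r p) (hu : u ≠ r) (i : ℕ) :
    (_root_.reattach p u r)^[i] u = p^[i] u := by
  induction i with
  | zero => rfl
  | succ i ih =>
    rw [Function.iterate_succ_apply', Function.iterate_succ_apply', ih, reattach_of_ne]
    rw [← Function.iterate_succ_apply' p]
    exact fun heq => hu (h.eq_root_of_iterate_eq i.succ_ne_zero heq)

lemma IsParentMap.isBranchV_reattach [Finite V] (h : IsParentMap G r p) (hu : u ≠ r)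
    (h' : IsParentMap G' r (_root_.reattach p u r)) (hr : IsBranchV G r) : IsBranchV G' r := by
  refine le_trans hr (Set.ncard_le_ncard (fun y hy => ?_) (Set.toFinite _))
  obtain ⟨hne, h1⟩ := (h.adj_iff _ _).1 hy
  refine (h'.adj_iff _ _).2 ⟨hne, Or.inr ?_⟩
  rw [h.map_root] at h1
  have hyr : p y = r := h1.resolve_left hne
  rw [reattach_of_ne (by rw [hyr]; exact hu.symm), hyr]

lemma IsParentMap.degN_reattach_eq_two_iff [Finite V] (h : IsParentMap G r p) (hu : u ≠ r)
    (h' : IsParentMap G' r (_root_.reattach p u r)) (hr : IsBranchV G r) (hub : IsBranchV G u)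
    (x : V) : degN G' x = 2 ↔ degN G x = 2 := by
  by_cases hxr : x = r
  · subst hxr
    have h1 : 3 ≤ _ := hr
    have h2 : 3 ≤ _ := h.isBranchV_reattach hu h' hr
    omega
  by_cases hxu : x = u
  · subst hxu
    have h1 : 3 ≤ _ := hub
    have h2 := h'.degN_eq hxr
    have h3 : {y | _root_.reattach p x r y = x} = ∅ := by
      ext y
      simp [reattach_eq_iff hxr]
    rw [h3, Set.ncard_empty] at h2
    omega
  · rw [h'.degN_eq hxr, h.degN_eq hxr]
    simp [reattach_eq_iff hxr, hxu]

lemma IsParentMap.isClimb_reattach [Finite V] (h : IsParentMap G r p) (hu : u ≠ r)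
    (h' : IsParentMap G' r (_root_.reattach p u r)) (hr : IsBranchV G r) (hub : IsBranchV G u)
    {v : V} {m : ℕ} (hm : IsClimb G p v m) :
    IsClimb G' (_root_.reattach p u r) v m := by
  have hdeg := h.degN_reattach_eq_two_iff hu h' hr hub
  obtain ⟨hm1, hm2, hm3⟩ := hm
  have key : ∀ i < m, (_root_.reattach p u r)^[i] v = p^[i] v := by
    intro i
    induction i with
    | zero => exact fun _ => rfl
    | succ i ih =>
      intro hi
      rw [Function.iterate_succ_apply', ih (by omega), Function.iterate_succ_apply',
        reattach_of_ne]
      rw [← Function.iterate_succ_apply' p]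
      intro heq
      have h1 := hm3 (i + 1) (by omega) hi
      have h2 : 3 ≤ degN G u := hub
      rw [heq] at h1
      omega
  refine ⟨hm1, ?_, fun i h1 h2 => ?_⟩
  · obtain ⟨i, rfl⟩ : ∃ i, m = i + 1 := ⟨m - 1, by omega⟩
    rw [Function.iterate_succ_apply', key i (by omega)]
    by_cases hi : p (p^[i] v) = u
    · rw [reattach_of_eq hi]
      have h2 : 3 ≤ _ := h.isBranchV_reattach hu h' hr
      omega
    · rw [reattach_of_ne hi, ← Function.iterate_succ_apply' p, Ne, hdeg]
      exact hm2
  · rw [key i h2, hdeg]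
    exact hm3 i h1 h2

lemma IsParentMap.segmentMultiset_reattach [Fintype V] (h : IsParentMap G r p) (hu : u ≠ r)
    (h' : IsParentMap G' r (_root_.reattach p u r)) (hr : IsBranchV G r) (hub : IsBranchV G u) :
    segmentMultiset G' = segmentMultiset G := by
  classical
  have hr' := h.isBranchV_reattach hu h' hr
  have hdeg := h.degN_reattach_eq_two_iff hu h' hr hub
  have hr2 : degN G r ≠ 2 := degN_ne_two_of_isLeafV_or_isBranchV (Or.inr hr)
  have hr2' : degN G' r ≠ 2 := degN_ne_two_of_isLeafV_or_isBranchV (Or.inr hr')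
  have hex : ∀ v, ∃ m, v ≠ r → IsClimb G p v m := fun v => by
    by_cases hv : v = r
    · exact ⟨0, fun h => absurd hv h⟩
    · obtain ⟨m, hm⟩ := h.exists_climb hr2 hv
      exact ⟨m, fun _ => hm⟩
  choose c hc using hex
  rw [h.segmentMultiset_eq hr2 (fun v => h.isLeafV_or_isBranchV hr) c hc,
    h'.segmentMultiset_eq hr2' (fun v => h'.isLeafV_or_isBranchV hr') c
      (fun v hv => h.isClimb_reattach hu h' hr hub (hc v hv))]
  simp only [Ne, hdeg]

lemma IsParentMap.descendants_reattach (h : IsParentMap G r p) {v : V}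
    (hvr : v ≠ r) (huv : u ∉ descendants p v) :
    descendants (_root_.reattach p u r) v = descendants p v := by
  have hr : ∀ m, p^[m] r = r := h.iterate_root
  ext x
  constructor
  · rintro ⟨m, hm⟩
    induction m generalizing x with
    | zero => exact ⟨0, hm⟩
    | succ m ih =>
      rw [Function.iterate_succ_apply] at hm
      by_cases hx : p x = u
      · rw [reattach_of_eq hx] at hm
        obtain ⟨n, hn⟩ := ih r hm
        exact absurd (hn.symm.trans (hr n)) hvr
      · rw [reattach_of_ne hx] at hm
        exact mem_descendants_of_map (ih _ hm)
  · rintro ⟨m, hm⟩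
    induction m generalizing x with
    | zero => exact ⟨0, hm⟩
    | succ m ih =>
      rw [Function.iterate_succ_apply] at hm
      refine mem_descendants_of_map ?_
      rw [reattach_of_ne]
      · exact ih _ hm
      · rintro rfl
        exact huv ⟨m, hm⟩

lemma descendants_reattach_self (hu : u ≠ r) : descendants (reattach p u r) u = {u} := by
  ext x
  constructor
  · rintro ⟨m, hm⟩
    cases m with
    | zero => exact hm
    | succ m =>
      rw [Function.iterate_succ_apply', reattach_eq_iff hu] at hm
      exact absurd rfl hm.2
  · rintro rfl
    exact mem_descendants_self _ _

lemma IsParentMap.ncard_descendants_iterate [Finite V] (h : IsParentMap G r p)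
    (hr : degN G r ≠ 2) (hu : u ≠ r) {m : ℕ} (hm : IsClimb G p u m) {i : ℕ} (hi : i < m) :
    (descendants p (p^[i] u)).ncard = (descendants p u).ncard + i := by
  induction i with
  | zero => rfl
  | succ i ih =>
    have hne := hm.iterate_ne_root hr hu
    have h1 : descendants p (p^[i + 1] u) = insert (p^[i + 1] u) (descendants p (p^[i] u)) := by
      ext x
      rw [Set.mem_insert_iff]
      constructor
      · rintro ⟨n, hn⟩
        cases n with
        | zero => exact Or.inl hn
        | succ n =>
          rw [Function.iterate_succ_apply'] at hn
          exact Or.inr ⟨n, h.eq_of_map_eq (hne (i + 1) hi) (hm.2.2 (i + 1) (by omega) hi) hn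
            (Function.iterate_succ_apply' p i u).symm⟩
      · rintro (rfl | hx)
        · exact mem_descendants_self _ _
        · exact descendants_trans hx ⟨1, (Function.iterate_succ_apply' p i u).symm⟩
    have h2 : p^[i + 1] u ∉ descendants p (p^[i] u) := by
      intro hmem
      have h3 := h.descendants_antisymm hmem ⟨1, (Function.iterate_succ_apply' p i u).symm⟩
      rw [Function.iterate_succ_apply'] at h3
      exact h.map_ne (hne i (by omega)) h3
    rw [h1, Set.ncard_insert_of_notMem h2, ih (by omega), add_assoc]

lemma choose_add_choose_lt {a b j k : ℕ} (ha : 1 ≤ a) (hb : 1 ≤ b) (hk : 2 ≤ k)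
    (hkab : k ≤ a + b + j) :
    (a + j).choose k + (b + j).choose k < j.choose k + (a + b + j).choose k := by
  obtain ⟨k, rfl⟩ : ∃ l, k = l + 2 := ⟨k - 2, by omega⟩
  have hpascal : ∀ m, (m + 1).choose (k + 2) = m.choose (k + 1) + m.choose (k + 2) :=
    fun m => Nat.choose_succ_succ m (k + 1)
  have hle : ∀ a, (a + j).choose (k + 2) + (b + j).choose (k + 2) ≤
      j.choose (k + 2) + (a + b + j).choose (k + 2) := by
    intro a
    induction a with
    | zero => simp
    | succ a ih =>
      rw [show a + 1 + j = (a + j) + 1 by ring, show a + 1 + b + j = (a + b + j) + 1 by ring,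
        hpascal, hpascal]
      have : (a + j).choose (k + 1) ≤ (a + b + j).choose (k + 1) :=
        Nat.choose_le_choose _ (by omega)
      omega
  obtain ⟨a, rfl⟩ : ∃ c, a = c + 1 := ⟨a - 1, by omega⟩
  obtain ⟨b, rfl⟩ : ∃ c, b = c + 1 := ⟨b - 1, by omega⟩
  have h1 := hle a
  have h2 : (a + j).choose (k + 1) ≤ (a + b + j).choose (k + 1) :=
    Nat.choose_le_choose _ (by omega)
  have h3 : (a + (b + 1) + j).choose (k + 1) =
      (a + b + j).choose k + (a + b + j).choose (k + 1) := by
    rw [show a + (b + 1) + j = (a + b + j) + 1 by ring, Nat.choose_succ_succ]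
  have h4 : 0 < (a + b + j).choose k := Nat.choose_pos (by omega)
  rw [show a + 1 + j = (a + j) + 1 by ring,
    show a + 1 + (b + 1) + j = (a + (b + 1) + j) + 1 by ring,
    hpascal, hpascal]
  omega

lemma sum_choose_add_choose_lt {a b s k n : ℕ} (ha : 1 ≤ a) (hb : 1 ≤ b) (hs : 1 ≤ s)
    (hk : 2 ≤ k) (hkab : k ≤ a + b) (hn : n = a + b + s + 1) :
    ∑ i ∈ range s, ((a + 1 + i).choose k + (n - (a + 1 + i)).choose k) <
      ∑ i ∈ range s, ((1 + i).choose k + (n - (1 + i)).choose k) := by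
  subst hn
  have h1 : ∑ i ∈ range s, (a + b + s + 1 - (a + 1 + i)).choose k =
      ∑ i ∈ range s, (b + (i + 1)).choose k := by
    rw [← sum_range_reflect]
    refine sum_congr rfl fun i hi => ?_
    have := mem_range.1 hi
    congr 1
    omega
  have h2 : ∑ i ∈ range s, (a + b + s + 1 - (1 + i)).choose k =
      ∑ i ∈ range s, (a + b + (i + 1)).choose k := by
    rw [← sum_range_reflect]
    refine sum_congr rfl fun i hi => ?_
    have := mem_range.1 hi
    congr 1
    omega
  rw [sum_add_distrib, sum_add_distrib, h1, h2, ← sum_add_distrib, ← sum_add_distrib]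
  refine sum_lt_sum_of_nonempty (nonempty_range_iff.2 (by omega)) fun i _ => ?_
  have := choose_add_choose_lt (j := i + 1) ha hb hk (by omega)
  rwa [show a + 1 + i = a + (i + 1) by ring, show 1 + i = i + 1 by ring]

lemma IsParentMap.steinerWiener_reattach_lt [Fintype V] (h : IsParentMap G r p) (hu : u ≠ r)
    (h' : IsParentMap G' r (_root_.reattach p u r)) (hr : IsBranchV G r) (hub : IsBranchV G u)
    {s k : ℕ} (hs : IsClimb G p u s) (hsr : p^[s] u = r) (hk : 2 ≤ k)
    (hkn : k ≤ Fintype.card V - s - 1) : steinerWiener G' k < steinerWiener G k := by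
  classical
  have hr2 : degN G r ≠ 2 := degN_ne_two_of_isLeafV_or_isBranchV (Or.inr hr)
  have hr2' : degN G' r ≠ 2 :=
    degN_ne_two_of_isLeafV_or_isBranchV (Or.inr (h.isBranchV_reattach hu h' hr))
  have hs1 := hs.1
  have hne := hs.iterate_ne_root hr2 hu
  have hd1 : ∀ i < s, (descendants p (p^[i] u)).ncard = (descendants p u).ncard + i :=
    fun i hi => h.ncard_descendants_iterate hr2 hu hs hi
  have hd2 : ∀ i < s, (descendants (_root_.reattach p u r) (p^[i] u)).ncard = 1 + i := by
    intro i hi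
    have := h'.ncard_descendants_iterate hr2' hu (h.isClimb_reattach hu h' hr hub hs) hi
    rwa [h.reattach_iterate hu, descendants_reattach_self hu, Set.ncard_singleton] at this
  have ha : 2 ≤ (descendants p u).ncard := by
    have h1 : 3 ≤ _ := hub
    have h2 := h.degN_eq hu
    obtain ⟨c, hc⟩ := Set.nonempty_of_ncard_ne_zero (s := {y | p y = u}) (by omega)
    have hcu : c ≠ u := fun heq => h.map_ne hu (heq ▸ hc)
    rw [← Set.ncard_pair hcu]
    refine Set.ncard_le_ncard ?_ (Set.toFinite _)
    rintro x (rfl | rfl)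
    · exact ⟨1, hc⟩
    · exact mem_descendants_self _ _
  have hb : (descendants p u).ncard + (s - 1) + 2 ≤ Fintype.card V := by
    rw [← hd1 (s - 1) (by omega)]
    set x := p^[s - 1] u with hx
    have hxr : x ≠ r := hne _ (by omega)
    obtain ⟨z, hz, hzx⟩ := Set.exists_ne_of_one_lt_ncard
      (lt_of_lt_of_le (by norm_num) hr : 1 < (G.neighborSet r).ncard) x
    obtain ⟨hzr, hz⟩ := (h.adj_iff _ _).1 hz
    rw [h.map_root] at hz
    have hz := hz.resolve_left hzr
    have hrx : r ∉ descendants p x := fun ⟨m, hm⟩ => hxr (hm ▸ h.iterate_root m)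
    have hzx' : z ∉ descendants p x := by
      rw [← map_mem_descendants_iff hzx, hz]
      exact hrx
    rw [← Set.ncard_pair hzr, ← Set.ncard_union_eq ?_ (Set.toFinite _) (Set.toFinite _),
      ← Nat.card_eq_fintype_card, ← Set.ncard_univ]
    · exact Set.ncard_le_ncard (Set.subset_univ _) (Set.toFinite _)
    · rw [Set.disjoint_right]
      rintro y (rfl | rfl)
      · exact hrx
      · exact hzx'
  have hinj : Set.InjOn (fun i => p^[i] u) (range s : Set ℕ) := by
    intro i hi j hj hij
    simp only [coe_range, Set.mem_Iio] at hi hj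
    have h1 := hd1 i hi
    have h2 := hd1 j hj
    simp only at hij
    rw [hij] at h1
    omega
  have hsub : (range s).image (fun i => p^[i] u) ⊆ univ.erase r := by
    intro x hx
    obtain ⟨i, hi, rfl⟩ := mem_image.1 hx
    exact mem_erase.2 ⟨hne i (mem_range.1 hi), mem_univ _⟩
  rw [h.steinerWiener_eq (by omega), h'.steinerWiener_eq (by omega), ← sum_sdiff hsub,
    ← sum_sdiff hsub (f := fun v => #{S ∈ powersetCard k (univ : Finset V) |
      Separates (descendants p v) S})]
  refine add_lt_add_of_le_of_lt (le_of_eq (sum_congr rfl fun v hv => ?_)) ?_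
  · rw [mem_sdiff, mem_erase] at hv
    rw [h.descendants_reattach hv.1.1]
    rintro ⟨m, rfl⟩
    refine hv.2 (mem_image.2 ⟨m, mem_range.2 ?_, rfl⟩)
    by_contra! hsm
    refine hv.1.1 ?_
    rw [← Nat.sub_add_cancel hsm, Function.iterate_add_apply, hsr, h.iterate_root]
  · rw [sum_image hinj, sum_image hinj]
    have e1 := sum_congr (rfl : range s = range s) fun i _ =>
      card_separates_add (descendants p (p^[i] u)) (k := k) (by omega)
    have e2 := sum_congr (rfl : range s = range s) fun i _ =>
      card_separates_add (descendants (_root_.reattach p u r) (p^[i] u)) (k := k) (by omega)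
    rw [sum_add_distrib] at e1 e2
    have e3 := sum_congr (rfl : range s = range s) fun i hi =>
      congrArg (fun d => d.choose k + (Fintype.card V - d).choose k) (hd1 i (mem_range.1 hi))
    have e4 := sum_congr (rfl : range s = range s) fun i hi =>
      congrArg (fun d => d.choose k + (Fintype.card V - d).choose k) (hd2 i (mem_range.1 hi))
    have key := sum_choose_add_choose_lt (a := (descendants p u).ncard - 1)
      (b := Fintype.card V - (descendants p u).ncard - s) (s := s) (k := k)
      (n := Fintype.card V) (by omega) (by omega) hs1 hk (by omega) (by omega)
    rw [Nat.sub_add_cancel (by omega : 1 ≤ (descendants p u).ncard)] at key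
    omega

end Reattach

/-- If `w 0, w 1, …, w s` is a segment of a tree `T` both of whose endpoints
`u₁ = w 0` and `u₂ = w s` are branch vertices, then moving all neighbours of `u₁` other than
`w 1` over to `u₂` produces a tree `T'` with the same segment sequence, and
`SW_k(T') < SW_k(T)` for every `2 ≤ k ≤ n - s - 1`. -/
theorem steinerWiener_lt_of_merging_branch_vertices {V : Type} [Fintype V]
    (T : SimpleGraph V) (hT : T.IsTree)
    (s : ℕ) (hs : 1 ≤ s) (w : Fin (s + 1) → V) (hinj : Function.Injective w)
    (hadj : ∀ i : Fin s, T.Adj (w i.castSucc) (w i.succ))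
    (hdeg2 : ∀ i : Fin (s + 1), i ≠ 0 → i ≠ Fin.last s → degN T (w i) = 2)
    (hb0 : IsBranchV T (w 0)) (hbs : IsBranchV T (w (Fin.last s)))
    (N : Set V) (hN : N = T.neighborSet (w 0) \ {w ⟨1, by omega⟩})
    (T' : SimpleGraph V)
    (hT' : T' = (T.deleteEdges {e | ∃ x ∈ N, e = s(w 0, x)}) ⊔
      SimpleGraph.fromEdgeSet {e | ∃ x ∈ N, e = s(w (Fin.last s), x)}) :
    T'.IsTree ∧ segmentMultiset T' = segmentMultiset T ∧
      ∀ k : ℕ, 2 ≤ k → k ≤ Fintype.card V - s - 1 →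
        steinerWiener T' k < steinerWiener T k := by
  obtain ⟨p, h⟩ := exists_isParentMap hT (w (Fin.last s))
  have hstep : ∀ i : Fin s, p (w i.castSucc) = w i.succ := by
    have key : ∀ n (i : Fin s), s - i.val ≤ n → p (w i.castSucc) = w i.succ := by
      intro n
      induction n with
      | zero => exact fun i hi => by omega
      | succ n ih =>
        intro i hi
        obtain ⟨-, h1 | h1⟩ := (h.adj_iff _ _).1 (hadj i)
        · exact h1
        exfalso
        by_cases hlast : i.val + 1 = s
        · have h2 : i.succ = Fin.last s := Fin.ext (by simpa using hlast)
          rw [h2, h.map_root] at h1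
          have := congrArg Fin.val (hinj h1)
          simp at this
          omega
        · have h2 := ih ⟨i.val + 1, by omega⟩ (by simp only; omega)
          have h3 : (⟨i.val + 1, by omega⟩ : Fin s).castSucc = i.succ := rfl
          rw [h3, h1] at h2
          have := congrArg Fin.val (hinj h2)
          simp only [Fin.val_castSucc, Fin.val_succ] at this
          omega
    exact fun i => key _ i le_rfl
  have hiter : ∀ i (hi : i < s + 1), p^[i] (w 0) = w ⟨i, hi⟩ := by
    intro i
    induction i with
    | zero => exact fun _ => rfl
    | succ i ih =>
      intro hi
      rw [Function.iterate_succ_apply', ih (by omega)]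
      exact hstep ⟨i, by omega⟩
  have hu : w 0 ≠ w (Fin.last s) := fun heq => by
    have := congrArg Fin.val (hinj heq)
    simp at this
    omega
  have hsr : p^[s] (w 0) = w (Fin.last s) := hiter s (by omega)
  have hclimb : IsClimb T p (w 0) s := by
    refine ⟨hs, ?_, fun i h1 h2 => ?_⟩
    · rw [hsr]
      exact degN_ne_two_of_isLeafV_or_isBranchV (Or.inr hbs)
    · rw [hiter i (by omega)]
      refine hdeg2 _ (fun heq => ?_) (fun heq => ?_)
      · have := congrArg Fin.val heq
        simp at this
        omega
      · have := congrArg Fin.val heq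
        simp at this
        omega
  have hpu : p (w 0) = w ⟨1, by omega⟩ := hiter 1 (by omega)
  have hmem : ∀ x, x ∈ N ↔ p x = w 0 := by
    intro x
    rw [hN, ← hpu, Set.mem_sdiff, neighborSet_eq_insert h hu, Set.mem_insert_iff,
      Set.mem_singleton_iff, Set.mem_ofPred_eq]
    constructor
    · rintro ⟨h1 | h1, h2⟩
      · exact absurd h1 h2
      · exact h1
    · intro h1
      refine ⟨Or.inr h1, ?_⟩
      rintro rfl
      exact h.map_map_ne hu h1
  have h' : IsParentMap T' (w (Fin.last s)) (reattach p (w 0) (w (Fin.last s))) := by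
    refine h.reattach hu fun x y => ?_
    rw [hT', sup_adj, deleteEdges_adj, fromEdgeSet_adj]
    simp only [Set.mem_ofPred_eq, hmem]
  exact ⟨h'.isTree, h.segmentMultiset_reattach hu h' hbs hb0, fun k hk hkn =>
    h.steinerWiener_reattach_lt hu h' hbs hb0 hclimb hsr hk hkn⟩
end

section
/- Let k ≥ 2 be an integer and let ℓ = (l_1, …, l_m) with m ≥ 3 be the segment sequence of some tree. Then there exists a tree T with segment sequence ℓ that maximizes the Steiner k-Wiener index SW_k among all trees with segment sequence ℓ and that is a quasi-caterpillar in which every branch vertex has degree 3 or 4, and every branch vertex of degree 4 is one of the two branch vertices closest to the two ends of the backbone. -/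
open SimpleGraph Finset

/-- A graph is a path graph if it has a Hamiltonian path. -/
def IsPathGraph {V : Type*} (G : SimpleGraph V) : Prop :=
  ∃ (u v : V) (w : G.Walk u v), w.IsPath ∧ ∀ x, x ∈ w.support

/-- The set of vertices lying on pendant segments, other than branch-vertex endpoints. -/
def pendantSegmentVertices {V : Type*} (G : SimpleGraph V) : Set V :=
  {x | ∃ (u v : V) (w : G.Walk u v), IsSegment G u v ∧ IsLeafV G u ∧ w.IsPath ∧
      (∀ y ∈ w.support, y ≠ u → y ≠ v → degN G y = 2) ∧ x ∈ w.support ∧ ¬ IsBranchV G x}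

/-- A quasi-caterpillar: a tree such that deleting all vertices of its pendant segments other
than their branch-vertex endpoints results in a path. -/
def IsQuasiCaterpillar {V : Type*} [Fintype V] (G : SimpleGraph V) : Prop :=
  G.IsTree ∧ IsPathGraph (G.induce (pendantSegmentVertices G)ᶜ)

/-- A backbone: a longest path containing all branch vertices. -/
def IsBackbone {V : Type*} (G : SimpleGraph V) {u v : V} (w : G.Walk u v) : Prop :=
  w.IsPath ∧ (∀ x, IsBranchV G x → x ∈ w.support) ∧
    ∀ (a b : V) (w' : G.Walk a b), w'.IsPath →
      (∀ x, IsBranchV G x → x ∈ w'.support) → w'.length ≤ w.length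

namespace SimpleGraph

section Cuts

variable {V : Type*} {G : SimpleGraph V}

/-- A property that propagates along edges and holds at one vertex of a connected graph holds
everywhere. -/
theorem Connected.forall_of_adj (hG : G.Connected) {P : V → Prop} {x₀ : V} (h₀ : P x₀)
    (h : ∀ x y, G.Adj x y → P x → P y) (x : V) : P x := by
  obtain ⟨w⟩ := hG x₀ x
  induction w with
  | nil => exact h₀
  | cons hadj _ ih => exact ih (h _ _ hadj h₀)

/-- A set without outgoing edges in a connected graph that misses a vertex is empty. -/
theorem Connected.notMem_of_closed (hG : G.Connected) {S : Set V} {x₀ : V} (h₀ : x₀ ∉ S)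
    (h : ∀ x y, G.Adj x y → x ∈ S → y ∉ S → False) (x : V) : x ∉ S := by
  refine hG.forall_of_adj (P := fun x => x ∉ S) h₀ (fun x y hxy hx hy => h y x hxy.symm hy hx) x

/-- The edge `e` is the only edge of `G` joining `c` to its complement. -/
def IsCut (G : SimpleGraph V) (e : Sym2 V) (c : Set V) : Prop :=
  ∀ ⦃x y⦄, G.Adj x y → (s(x, y) = e ↔ ¬(x ∈ c ↔ y ∈ c))

/-- All edges leaving `S` end in `p`, which is not in `S`. -/
def Hangs (G : SimpleGraph V) (p : V) (S : Set V) : Prop :=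
  p ∉ S ∧ ∀ ⦃x y⦄, G.Adj x y → x ∈ S → y ∉ S → y = p

/-- The branch at `p` in the direction of `a`. -/
def branchAt (G : SimpleGraph V) (p a : V) : Set V :=
  {z | (G.deleteEdges {s(p, a)}).Reachable a z}

theorem IsCut.compl {e : Sym2 V} {c : Set V} (h : G.IsCut e c) : G.IsCut e cᶜ := by
  intro x y hxy
  rw [h hxy]
  simp only [Set.mem_compl_iff]
  tauto

theorem right_mem_branchAt {p a : V} : a ∈ G.branchAt p a := Reachable.refl _

theorem IsAcyclic.left_notMem_branchAt (hG : G.IsAcyclic) {p a : V} (h : G.Adj p a) :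
    p ∉ G.branchAt p a := fun hp =>
  isBridge_iff.mp (isAcyclic_iff_forall_adj_isBridge.mp hG h) hp.symm

theorem mem_branchAt_of_adj {p a x y : V} (hx : x ∈ G.branchAt p a) (hxy : G.Adj x y)
    (hne : s(x, y) ≠ s(p, a)) : y ∈ G.branchAt p a := by
  refine Reachable.trans hx (Adj.reachable ?_)
  simp [deleteEdges_adj, hxy, hne]

theorem IsAcyclic.isCut_branchAt (hG : G.IsAcyclic) {p a : V} (h : G.Adj p a) :
    G.IsCut s(p, a) (G.branchAt p a) := by
  have hp := hG.left_notMem_branchAt h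
  have ha : a ∈ G.branchAt p a := right_mem_branchAt
  intro x y hxy
  constructor
  · intro he
    rcases Sym2.eq_iff.mp he with ⟨rfl, rfl⟩ | ⟨rfl, rfl⟩ <;> tauto
  · intro hne
    by_contra he
    apply hne
    exact ⟨fun hx => mem_branchAt_of_adj hx hxy he,
      fun hy => mem_branchAt_of_adj hy hxy.symm (by rwa [Sym2.eq_swap])⟩

theorem IsAcyclic.hangs_branchAt (hG : G.IsAcyclic) {p a : V} (h : G.Adj p a) :
    G.Hangs p (G.branchAt p a) := by
  have hp := hG.left_notMem_branchAt h
  refine ⟨hp, fun x y hxy hx hy => ?_⟩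
  have := (hG.isCut_branchAt h hxy).mpr (by tauto)
  rcases Sym2.eq_iff.mp this with ⟨rfl, rfl⟩ | ⟨rfl, rfl⟩
  · exact absurd hx hp
  · rfl

theorem IsAcyclic.exists_isCut (hG : G.IsAcyclic) {e : Sym2 V} (he : e ∈ G.edgeSet) :
    ∃ c, G.IsCut e c := by
  induction e with
  | h p a => exact ⟨_, hG.isCut_branchAt he⟩

theorem Hangs.union {p : V} {S T : Set V} (hS : G.Hangs p S) (hT : G.Hangs p T) :
    G.Hangs p (S ∪ T) := by
  refine ⟨fun h => h.elim hS.1 hT.1, fun x y hxy hx hy => ?_⟩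
  simp only [Set.mem_union, not_or] at hx hy
  exact hx.elim (fun h => hS.2 hxy h hy.1) (fun h => hT.2 hxy h hy.2)

/-- Walking away from `p` without returning, one stays in a set hanging at `p`. -/
theorem Hangs.mem_of_walk {p : V} {S : Set V} (hS : G.Hangs p S) {x y : V} (w : G.Walk x y)
    (hx : x ∈ S) (hp : p ∉ w.support) : y ∈ S := by
  induction w with
  | nil => exact hx
  | @cons a b _ hadj w ih =>
    simp only [Walk.support_cons, List.mem_cons, not_or] at hp
    refine ih ?_ hp.2
    by_contra hb
    exact hp.2 (hS.2 hadj hx hb ▸ w.start_mem_support)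

/-- The far side of a cut separating `p` from `q` is disjoint from every set hanging at `p` that
does not contain `q`. -/
theorem IsCut.disjoint_hangs (hG : G.Connected) {p q : V} {e : Sym2 V} {c S : Set V}
    (hc : G.IsCut e c) (hp : p ∉ c) (hq : q ∈ c) (hS : G.Hangs p S) (hqS : q ∉ S) :
    Disjoint c S := by
  have key : ∀ x y, G.Adj x y → x ∈ c ∩ S → y ∉ c ∩ S → s(x, y) = e := by
    rintro x y hxy ⟨hx1, hx2⟩ hy
    by_cases hyS : y ∈ S
    · exact (hc hxy).mpr fun h => hy ⟨h.mp hx1, hyS⟩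
    · obtain rfl := hS.2 hxy hx2 hyS
      exact (hc hxy).mpr (by tauto)
  rw [Set.disjoint_left]
  intro z hzc hzS
  by_cases hcross : ∃ x y, G.Adj x y ∧ x ∈ c ∩ S ∧ y ∉ c ∩ S
  · obtain ⟨x, y, hxy, hx, hy⟩ := hcross
    have he := key x y hxy hx hy
    refine hG.notMem_of_closed (S := c \ S) (x₀ := p) (fun h => hp h.1) ?_ q ⟨hq, hqS⟩
    rintro a b hab ⟨ha1, ha2⟩ hb
    by_cases hbc : b ∈ c
    · have hbS : b ∈ S := by
        by_contra h
        exact hb ⟨hbc, h⟩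
      exact hp (hS.2 hab.symm hbS ha2 ▸ ha1)
    · have hab' : s(a, b) = e := (hc hab).mpr (by tauto)
      rw [← he] at hab'
      rcases Sym2.eq_iff.mp hab' with ⟨rfl, rfl⟩ | ⟨rfl, rfl⟩
      · exact ha2 hx.2
      · exact hbc hx.1
  · push Not at hcross
    exact hG.notMem_of_closed (S := c ∩ S) (x₀ := p) (fun h => hp h.1)
      (fun x y hxy hx hy => hy (hcross x y hxy hx)) z ⟨hzc, hzS⟩

/-- The far side of a cut separating `p` from `q` is contained in every set hanging at `p` that
contains `q`. -/
theorem IsCut.subset_hangs (hG : G.Connected) {p q : V} {e : Sym2 V} {c R : Set V}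
    (hc : G.IsCut e c) (hp : p ∉ c) (hq : q ∈ c) (hR : G.Hangs p R) (hqR : q ∈ R) :
    c ⊆ R := by
  intro z hz
  by_contra hzR
  by_cases hcross : ∃ x y, G.Adj x y ∧ x ∈ c \ R ∧ y ∉ c
  · obtain ⟨x, y, hxy, hx, hy⟩ := hcross
    have he : s(x, y) = e := (hc hxy).mpr (by have := hx.1; tauto)
    refine hG.notMem_of_closed (S := c ∩ R) (x₀ := p) (fun h => hp h.1) ?_ q ⟨hq, hqR⟩
    rintro a b hab ⟨ha1, ha2⟩ hb
    by_cases hbc : b ∈ c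
    · have hbR : b ∉ R := fun h => hb ⟨hbc, h⟩
      exact hp (hR.2 hab ha2 hbR ▸ hbc)
    · have hab' : s(a, b) = e := (hc hab).mpr (by tauto)
      rw [← he] at hab'
      rcases Sym2.eq_iff.mp hab' with ⟨rfl, rfl⟩ | ⟨rfl, rfl⟩
      · exact hx.2 ha2
      · exact hbc hx.1
  · push Not at hcross
    refine hG.notMem_of_closed (S := c \ R) (x₀ := p) (fun h => hp h.1) ?_ z ⟨hz, hzR⟩
    rintro x y hxy hx hy
    have hyc := hcross x y hxy hx
    have hyR : y ∈ R := by
      by_contra h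
      exact hy ⟨hyc, h⟩
    exact hp (hR.2 hxy.symm hyR hx.2 ▸ hx.1)

theorem IsTree.exists_mem_branchAt (hG : G.IsTree) {p q : V} (hpq : p ≠ q) :
    ∃ a, G.Adj p a ∧ q ∈ G.branchAt p a := by
  by_contra hcon
  push Not at hcon
  refine hG.connected.notMem_of_closed (S := {z | z ≠ p ∧ ∀ a, G.Adj p a → z ∉ G.branchAt p a})
    (x₀ := p) (fun h => h.1 rfl) ?_ q ⟨hpq.symm, fun a ha => hcon a ha⟩
  rintro x y hxy ⟨hx1, hx2⟩ hy
  by_cases hyp : y = p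
  · subst hyp
    exact hx2 x hxy.symm right_mem_branchAt
  · simp only [Set.mem_ofPred_eq, not_and, not_forall, not_not] at hy
    obtain ⟨a, ha, hya⟩ := hy hyp
    exact hx1 ((hG.isAcyclic.hangs_branchAt ha).2 hxy.symm hya (hx2 a ha))

theorem IsTree.disjoint_branchAt (hG : G.IsTree) {p a b : V} (ha : G.Adj p a) (hb : G.Adj p b)
    (hab : a ≠ b) : Disjoint (G.branchAt p a) (G.branchAt p b) := by
  have hb' : b ∉ G.branchAt p a := by
    intro h
    have := (hG.isAcyclic.isCut_branchAt ha hb).mpr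
      (by have := hG.isAcyclic.left_notMem_branchAt ha; tauto)
    rcases Sym2.eq_iff.mp this with ⟨-, rfl⟩ | ⟨rfl, rfl⟩
    · exact hab rfl
    · exact hab rfl
  refine ((hG.isAcyclic.isCut_branchAt hb).disjoint_hangs hG.connected
    (hG.isAcyclic.left_notMem_branchAt hb) right_mem_branchAt
    (hG.isAcyclic.hangs_branchAt ha) hb').symm

theorem IsTree.mem_branchAt_iff_eq (hG : G.IsTree) {p a b : V} (ha : G.Adj p a) (hb : G.Adj p b) :
    b ∈ G.branchAt p a ↔ b = a := by
  constructor
  · intro h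
    by_contra hne
    exact Set.disjoint_left.mp (hG.disjoint_branchAt ha hb (Ne.symm hne)) h right_mem_branchAt
  · rintro rfl
    exact right_mem_branchAt

/-- Branches pointing away from `p` at a vertex of a branch at `p` are contained in it. -/
theorem IsTree.branchAt_subset (hG : G.IsTree) {p a y b : V} (ha : G.Adj p a) (hb : G.Adj y b)
    (hy : y ∈ G.branchAt p a) (hp : p ∉ G.branchAt y b) :
    G.branchAt y b ⊆ G.branchAt p a \ {y} := by
  have hyb := hG.isAcyclic.left_notMem_branchAt hb
  refine Set.subset_sdiff_singleton ?_ hyb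
  intro z hz
  by_contra hza
  refine hG.connected.notMem_of_closed (S := G.branchAt y b \ G.branchAt p a) (x₀ := p)
    (fun h => hp h.1) ?_ z ⟨hz, hza⟩
  rintro u v huv ⟨hu1, hu2⟩ hv
  by_cases hvb : v ∈ G.branchAt y b
  · have hva : v ∈ G.branchAt p a := by
      by_contra h
      exact hv ⟨hvb, h⟩
    exact hp ((hG.isAcyclic.hangs_branchAt ha).2 huv.symm hva hu2 ▸ hu1)
  · obtain rfl := (hG.isAcyclic.hangs_branchAt hb).2 huv hu1 hvb
    exact hp ((hG.isAcyclic.hangs_branchAt ha).2 huv.symm hy hu2 ▸ hu1)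

end Cuts

section Steiner

variable {V : Type*} {G : SimpleGraph V}

/-- The ends of a trail are separated exactly by the cuts of the edges it uses. -/
theorem IsCut.mem_edges_iff {e : Sym2 V} {c : Set V} (hc : G.IsCut e c) {x y : V}
    (w : G.Walk x y) (hw : w.IsTrail) : e ∈ w.edges ↔ ¬(x ∈ c ↔ y ∈ c) := by
  induction w with
  | nil => simp
  | @cons a b d hadj w ih =>
    rw [Walk.isTrail_cons] at hw
    have h1 := hc hadj
    have h2 := ih hw.1
    rw [Walk.edges_cons, List.mem_cons]
    by_cases he : s(a, b) = e
    · have := he ▸ hw.2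
      tauto
    · have : e ≠ s(a, b) := fun h => he h.symm
      tauto

theorem IsTree.steinerDist_eq [Finite V] (hG : G.IsTree) {c : Sym2 V → Set V}
    (hc : ∀ e ∈ G.edgeSet, G.IsCut e (c e)) {S : Finset V} (hS : S.Nonempty) :
    steinerDist G S = {e ∈ G.edgeSet | ∃ s ∈ S, ∃ t ∈ S, s ∈ c e ∧ t ∉ c e}.ncard := by
  classical
  set E : Set (Sym2 V) := {e ∈ G.edgeSet | ∃ s ∈ S, ∃ t ∈ S, s ∈ c e ∧ t ∉ c e} with hE
  have lower : ∀ H : G.Subgraph, H.Connected → ↑S ⊆ H.verts → E ⊆ H.edgeSet := by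
    rintro H hH hSH e ⟨heG, s, hs, t, ht, hsc, htc⟩
    by_contra heH
    have hconn : H.coe.Connected := (Subgraph.connected_iff'.mp hH)
    refine hconn.notMem_of_closed (S := {z : H.verts | (z : V) ∈ c e}) (x₀ := ⟨t, hSH ht⟩) htc ?_
      ⟨s, hSH hs⟩ hsc
    rintro ⟨x, hx⟩ ⟨y, hy⟩ hxy hxc hyc
    have hxy' : H.Adj x y := hxy
    have hxc' : x ∈ c e := hxc
    have hyc' : y ∉ c e := hyc
    have := (hc e heG hxy'.adj_sub).mpr (by tauto)
    exact heH (this ▸ hxy')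
  obtain ⟨s₀, hs₀⟩ := hS
  have upper : ∀ T : Finset V, ∃ H : G.Subgraph, H.Connected ∧ s₀ ∈ H.verts ∧ ↑T ⊆ H.verts ∧
      ∀ e ∈ H.edgeSet, ∃ t ∈ T, ¬(s₀ ∈ c e ↔ t ∈ c e) := by
    intro T
    induction T using Finset.induction_on with
    | empty =>
      refine ⟨G.singletonSubgraph s₀, Subgraph.singletonSubgraph_connected, by simp, by simp, ?_⟩
      intro e he
      simp at he
    | insert a T _ ih =>
      obtain ⟨H, hH, hs, hT, hedge⟩ := ih
      obtain ⟨w, hw⟩ := (hG.connected s₀ a).exists_isPath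
      have hsw : s₀ ∈ w.toSubgraph.verts := w.start_mem_verts_toSubgraph
      refine ⟨H ⊔ w.toSubgraph, ?_, Or.inl hs, ?_, ?_⟩
      · exact Subgraph.connected_sup hH.preconnected w.toSubgraph_connected.preconnected
          ⟨s₀, hs, hsw⟩
      · intro x hx
        rw [Finset.coe_insert, Set.mem_insert_iff] at hx
        rcases hx with rfl | hx
        · exact Or.inr w.end_mem_verts_toSubgraph
        · exact Or.inl (hT hx)
      · intro e he
        rw [Subgraph.edgeSet_sup] at he
        rcases he with he | he
        · obtain ⟨t, ht, h⟩ := hedge e he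
          exact ⟨t, Finset.mem_insert_of_mem ht, h⟩
        · rw [Walk.mem_edges_toSubgraph] at he
          exact ⟨a, Finset.mem_insert_self _ _,
            ((hc e (w.edges_subset_edgeSet he)).mem_edges_iff w hw.isTrail).mp he⟩
  obtain ⟨H, hH, -, hSH, hedge⟩ := upper S
  have hHE : H.edgeSet = E := by
    refine Set.Subset.antisymm (fun e he => ⟨H.edgeSet_subset he, ?_⟩) (lower H hH hSH)
    obtain ⟨t, ht, h⟩ := hedge e he
    by_cases h₀ : s₀ ∈ c e
    · exact ⟨s₀, hs₀, t, ht, h₀, by tauto⟩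
    · exact ⟨t, ht, s₀, hs₀, by tauto, h₀⟩
  apply le_antisymm
  · exact Nat.sInf_le ⟨H, hH, hSH, by rw [hHE]⟩
  · refine le_csInf ⟨_, H, hH, hSH, rfl⟩ ?_
    rintro n ⟨K, hK, hSK, rfl⟩
    exact Set.ncard_le_ncard (lower K hK hSK) (Set.toFinite _)

/-- The number of `k`-subsets of an `n`-set that meet both parts of a bipartition with a part of
size `a`. -/
def splitCount (n k a : ℕ) : ℕ := n.choose k - (a.choose k + (n - a).choose k)

theorem card_filter_powersetCard_split [Fintype V] {k : ℕ} (hk : 1 ≤ k) (c : Set V)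
    [DecidablePred fun S : Finset V => ∃ s ∈ S, ∃ t ∈ S, s ∈ c ∧ t ∉ c] :
    #{S ∈ powersetCard k (univ : Finset V) | ∃ s ∈ S, ∃ t ∈ S, s ∈ c ∧ t ∉ c} +
      (c.ncard.choose k + (Fintype.card V - c.ncard).choose k) = (Fintype.card V).choose k := by
  classical
  have hmono : #{S ∈ powersetCard k (univ : Finset V) | ¬ ∃ s ∈ S, ∃ t ∈ S, s ∈ c ∧ t ∉ c} =
      c.ncard.choose k + (Fintype.card V - c.ncard).choose k := by
    have h1 : {S ∈ powersetCard k (univ : Finset V) | ¬ ∃ s ∈ S, ∃ t ∈ S, s ∈ c ∧ t ∉ c} =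
        powersetCard k c.toFinset ∪ powersetCard k c.toFinsetᶜ := by
      ext S
      simp only [Finset.mem_filter, mem_powersetCard, Finset.mem_union, subset_iff, mem_univ,
        Set.mem_toFinset, mem_compl]
      constructor
      · rintro ⟨⟨-, hS⟩, h⟩
        by_cases hex : ∃ t ∈ S, t ∉ c
        · right
          obtain ⟨t, ht, htc⟩ := hex
          exact ⟨fun s hs hsc => h ⟨s, hs, t, ht, hsc, htc⟩, hS⟩
        · left
          push Not at hex
          exact ⟨fun s hs => hex s hs, hS⟩
      · rintro (⟨h, hS⟩ | ⟨h, hS⟩)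
        · exact ⟨⟨by simp, hS⟩, fun ⟨s, hs, t, ht, hsc, htc⟩ => htc (h ht)⟩
        · exact ⟨⟨by simp, hS⟩, fun ⟨s, hs, t, ht, hsc, htc⟩ => h hs hsc⟩
    have h2 : Disjoint (powersetCard k c.toFinset) (powersetCard k c.toFinsetᶜ) := by
      rw [Finset.disjoint_left]
      intro S hS hS'
      rw [mem_powersetCard] at hS hS'
      have hne : S.Nonempty := by
        rw [← Finset.card_pos]
        omega
      obtain ⟨s, hs⟩ := hne
      exact (mem_compl.mp (hS'.1 hs)) (hS.1 hs)
    rw [h1, card_union_of_disjoint h2, card_powersetCard, card_powersetCard, card_compl,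
      Set.ncard_eq_toFinset_card']
  rw [← hmono, card_filter_add_card_filter_not, card_powersetCard, card_univ]

theorem splitCount_add [Fintype V] {k : ℕ} (hk : 1 ≤ k) (c : Set V) :
    splitCount (Fintype.card V) k c.ncard +
      (c.ncard.choose k + (Fintype.card V - c.ncard).choose k) = (Fintype.card V).choose k := by
  classical
  have := card_filter_powersetCard_split hk c
  unfold splitCount
  omega

theorem IsTree.steinerWiener_eq [Fintype V] (hG : G.IsTree) {k : ℕ} (hk : 1 ≤ k)
    {c : Sym2 V → Set V} (hc : ∀ e ∈ G.edgeSet, G.IsCut e (c e)) :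
    steinerWiener G k =
      ∑ e ∈ (Set.toFinite G.edgeSet).toFinset, splitCount (Fintype.card V) k (c e).ncard := by
  classical
  have h1 : ∀ S ∈ powersetCard k (univ : Finset V), steinerDist G S =
      ∑ e ∈ (Set.toFinite G.edgeSet).toFinset,
        if ∃ s ∈ S, ∃ t ∈ S, s ∈ c e ∧ t ∉ c e then 1 else 0 := by
    intro S hS
    have hne : S.Nonempty := by
      rw [← Finset.card_pos]
      have := (mem_powersetCard.mp hS).2
      omega
    rw [hG.steinerDist_eq hc hne, ← Finset.card_filter, ← Set.ncard_coe_finset]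
    congr 1
    ext e
    simp
  rw [steinerWiener, Finset.sum_congr rfl h1, Finset.sum_comm]
  refine Finset.sum_congr rfl fun e _ => ?_
  rw [← Finset.card_filter]
  have h2 := card_filter_powersetCard_split hk (c e)
  unfold splitCount
  omega

theorem choose_add_choose_le {k x y : ℕ} (hxy : x ≤ y) (d : ℕ) :
    (x + d).choose k + y.choose k ≤ x.choose k + (y + d).choose k := by
  induction d with
  | zero => simp
  | succ d ih =>
    cases k with
    | zero => simp
    | succ k =>
      have h1 := Nat.choose_succ_succ' (x + d) k
      have h2 := Nat.choose_succ_succ' (y + d) k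
      have h3 : (x + d).choose k ≤ (y + d).choose k := Nat.choose_le_choose k (by omega)
      rw [← add_assoc, ← add_assoc]
      omega

theorem choose_two_add_choose_two (x y d : ℕ) :
    (x + d).choose 2 + y.choose 2 + y * d = x.choose 2 + (y + d).choose 2 + x * d := by
  induction d with
  | zero => simp
  | succ d ih =>
    have h1 := Nat.choose_succ_succ' (x + d) 1
    have h2 := Nat.choose_succ_succ' (y + d) 1
    rw [Nat.choose_one_right] at h1 h2
    norm_num at h1 h2
    rw [← add_assoc, ← add_assoc, mul_add, mul_add, h1, h2]
    omega

theorem splitCount_le [Fintype V] {k : ℕ} {c d : Set V} (h : c.ncard ≤ d.ncard)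
    (h' : c.ncard + d.ncard ≤ Fintype.card V) :
    splitCount (Fintype.card V) k c.ncard ≤ splitCount (Fintype.card V) k d.ncard := by
  have := choose_add_choose_le (k := k) (x := c.ncard) (y := Fintype.card V - d.ncard)
    (by omega) (d.ncard - c.ncard)
  rw [show c.ncard + (d.ncard - c.ncard) = d.ncard by omega,
    show Fintype.card V - d.ncard + (d.ncard - c.ncard) = Fintype.card V - c.ncard by omega] at this
  unfold splitCount
  omega

theorem splitCount_two_lt [Fintype V] {c d : Set V} (h : c.ncard < d.ncard)
    (h' : c.ncard + d.ncard < Fintype.card V) :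
    splitCount (Fintype.card V) 2 c.ncard < splitCount (Fintype.card V) 2 d.ncard := by
  have h1 := choose_two_add_choose_two c.ncard (Fintype.card V - d.ncard) (d.ncard - c.ncard)
  have h2 : c.ncard * (d.ncard - c.ncard) < (Fintype.card V - d.ncard) * (d.ncard - c.ncard) :=
    Nat.mul_lt_mul_of_pos_right (by omega) (by omega)
  rw [show c.ncard + (d.ncard - c.ncard) = d.ncard by omega,
    show Fintype.card V - d.ncard + (d.ncard - c.ncard) = Fintype.card V - c.ncard by omega] at h1
  have h3 := splitCount_add (V := V) (k := 2) (by norm_num) c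
  unfold splitCount at h3 ⊢
  omega

end Steiner

section ExchangeBranches

variable {V : Type*} {G : SimpleGraph V} {M : Set V} {p q : V}

open Classical in
/-- The vertex `x` as seen from `y` after exchanging the attachment vertices `p` and `q` of `M`. -/
noncomputable def twist (M : Set V) (p q x y : V) : V :=
  if x ∉ M ∧ y ∈ M then Equiv.swap p q x else x

/-- The graph obtained from `G` by exchanging the vertices `p` and `q` in all edges leaving `M`. -/
def exchange (G : SimpleGraph V) (M : Set V) (p q : V) : SimpleGraph V where
  Adj x y := G.Adj (twist M p q x y) (twist M p q y x)
  symm := ⟨fun _ _ h => h.symm⟩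
  loopless := ⟨fun _ h => G.loopless.irrefl _ h⟩

/-- The action of `exchange` on edges. -/
noncomputable def twistEdge (M : Set V) (p q : V) : Sym2 V → Sym2 V :=
  Sym2.lift ⟨fun x y => s(twist M p q x y, twist M p q y x), fun _ _ => Sym2.eq_swap⟩

theorem twistEdge_mk (x y : V) :
    twistEdge M p q s(x, y) = s(twist M p q x y, twist M p q y x) := rfl

theorem exchange_adj {x y : V} :
    (G.exchange M p q).Adj x y ↔ G.Adj (twist M p q x y) (twist M p q y x) := Iff.rfl

theorem twist_of_mem_left {x y : V} (hx : x ∈ M) : twist M p q x y = x := by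
  simp [twist, hx]

theorem twist_of_notMem_right {x y : V} (hy : y ∉ M) : twist M p q x y = x := by
  simp [twist, hy]

theorem twist_of_ne {x y : V} (hp : x ≠ p) (hq : x ≠ q) : twist M p q x y = x := by
  classical
  simp [twist, Equiv.swap_apply_of_ne_of_ne hp hq]

theorem twist_left {y : V} (hp : p ∉ M) (hy : y ∈ M) : twist M p q p y = q := by
  simp [twist, hp, hy]

theorem twist_right {y : V} (hq : q ∉ M) (hy : y ∈ M) : twist M p q q y = p := by
  simp [twist, hq, hy]

theorem twist_mem_iff (hp : p ∉ M) (hq : q ∉ M) {x y : V} : twist M p q x y ∈ M ↔ x ∈ M := by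
  by_cases hy : y ∈ M
  · by_cases h1 : x = p
    · rw [h1, twist_left hp hy]
      tauto
    · by_cases h2 : x = q
      · rw [h2, twist_right hq hy]
        tauto
      · rw [twist_of_ne h1 h2]
  · rw [twist_of_notMem_right hy]

theorem twist_twist (hp : p ∉ M) (hq : q ∉ M) {x y z : V} (hz : z ∈ M ↔ y ∈ M) :
    twist M p q (twist M p q x y) z = x := by
  by_cases hy : y ∈ M
  · by_cases h1 : x = p
    · rw [h1, twist_left hp hy, twist_right hq (hz.mpr hy)]
    · by_cases h2 : x = q
      · rw [h2, twist_right hq hy, twist_left hp (hz.mpr hy)]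
      · rw [twist_of_ne h1 h2, twist_of_ne h1 h2]
  · rw [twist_of_notMem_right hy, twist_of_notMem_right (fun h => hy (hz.mp h))]

theorem twistEdge_twistEdge (hp : p ∉ M) (hq : q ∉ M) (e : Sym2 V) :
    twistEdge M p q (twistEdge M p q e) = e := by
  induction e with
  | h x y =>
    rw [twistEdge_mk, twistEdge_mk, twist_twist hp hq (twist_mem_iff hp hq),
      twist_twist hp hq (twist_mem_iff hp hq)]

theorem exchange_exchange (hp : p ∉ M) (hq : q ∉ M) :
    (G.exchange M p q).exchange M p q = G := by
  ext x y
  rw [exchange_adj, exchange_adj, twist_twist hp hq (twist_mem_iff hp hq),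
      twist_twist hp hq (twist_mem_iff hp hq)]

theorem mem_edgeSet_exchange {e : Sym2 V} :
    e ∈ (G.exchange M p q).edgeSet ↔ twistEdge M p q e ∈ G.edgeSet := by
  induction e with
  | h x y => rfl

theorem twistEdge_mem_edgeSet_exchange (hp : p ∉ M) (hq : q ∉ M) {e : Sym2 V} :
    twistEdge M p q e ∈ (G.exchange M p q).edgeSet ↔ e ∈ G.edgeSet := by
  rw [mem_edgeSet_exchange, twistEdge_twistEdge hp hq]

open Classical in
/-- The action of `exchange` on the sides of cuts. -/
noncomputable def twistCut (M : Set V) (p q : V) (c : Set V) : Set V :=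
  if p ∈ c ↔ q ∈ c then c else symmDiff c M

/-- How `twistCut` behaves along an edge of the exchanged graph. -/
theorem twistCut_mem_iff (hp : p ∉ M) (hq : q ∉ M)
    (hM : ∀ x y, G.Adj x y → x ∈ M → y ∉ M → y = p ∨ y = q) (c : Set V) {x y : V}
    (hxy : (G.exchange M p q).Adj x y) :
    (x ∈ twistCut M p q c ↔ y ∈ twistCut M p q c) ↔
      (twist M p q x y ∈ c ↔ twist M p q y x ∈ c) := by
  have key : ∀ x y, (G.exchange M p q).Adj x y → x ∉ M → y ∈ M →
      ((x ∈ twistCut M p q c ↔ y ∈ twistCut M p q c) ↔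
      (twist M p q x y ∈ c ↔ twist M p q y x ∈ c)) := by
    intro x y hxy hx hy
    rw [exchange_adj, twist_of_mem_left hy] at hxy
    rw [twist_of_mem_left hy]
    have hout := hM _ _ hxy.symm hy (by rwa [twist_mem_iff hp hq])
    have hx' : (x = p ∧ twist M p q x y = q) ∨ (x = q ∧ twist M p q x y = p) := by
      have h := twist_twist hp hq (x := x) (y := y) (z := y) Iff.rfl
      rcases hout with h1 | h1
      · rw [h1, twist_left hp hy] at h
        exact Or.inr ⟨h.symm, h1⟩
      · rw [h1, twist_right hq hy] at h
        exact Or.inl ⟨h.symm, h1⟩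
    unfold twistCut
    split_ifs with hpq
    · rcases hx' with ⟨h1, h2⟩ | ⟨h1, h2⟩ <;> rw [h2, h1] <;> tauto
    · rw [Set.mem_symmDiff, Set.mem_symmDiff]
      rcases hx' with ⟨h1, h2⟩ | ⟨h1, h2⟩ <;> rw [h2, h1] <;> tauto
  by_cases hx : x ∈ M <;> by_cases hy : y ∈ M
  · rw [twist_of_mem_left hx, twist_of_mem_left hy]
    unfold twistCut
    split_ifs
    · rfl
    · rw [Set.mem_symmDiff, Set.mem_symmDiff]
      tauto
  · have := key y x hxy.symm hy hx
    tauto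
  · exact key x y hxy hx hy
  · rw [twist_of_notMem_right hx, twist_of_notMem_right hy]
    unfold twistCut
    split_ifs
    · rfl
    · rw [Set.mem_symmDiff, Set.mem_symmDiff]
      tauto

theorem IsCut.exchange (hp : p ∉ M) (hq : q ∉ M)
    (hM : ∀ x y, G.Adj x y → x ∈ M → y ∉ M → y = p ∨ y = q) {e : Sym2 V} {c : Set V}
    (hc : G.IsCut e c) :
    (G.exchange M p q).IsCut (twistEdge M p q e) (twistCut M p q c) := by
  intro x y hxy
  rw [twistCut_mem_iff hp hq hM c hxy, ← hc hxy, ← twistEdge_mk]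
  constructor
  · intro h
    rw [h, twistEdge_twistEdge hp hq]
  · rintro rfl
    rw [twistEdge_twistEdge hp hq]

theorem IsTree.exchange [Finite V] (hG : G.IsTree) (hp : p ∉ M) (hq : q ∉ M)
    (hM : ∀ x y, G.Adj x y → x ∈ M → y ∉ M → y = p ∨ y = q) :
    (G.exchange M p q).IsTree := by
  have hM' : ∀ x y, (G.exchange M p q).Adj x y → x ∈ M → y ∉ M → y = p ∨ y = q := by
    intro x y hxy hx hy
    rw [exchange_adj, twist_of_mem_left hx] at hxy
    by_contra hne
    push Not at hne
    rw [twist_of_ne hne.1 hne.2] at hxy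
    have := hM x y hxy hx hy
    tauto
  rw [isTree_iff_connected_and_card]
  constructor
  · have : Nonempty V := ⟨p⟩
    refine ⟨fun u v => ?_⟩
    -- the component of `u` pulls back to a set that is closed in `G`
    set S : Set V := {y | (G.exchange M p q).Reachable u y} with hS
    have hu : u ∈ S := Reachable.refl _
    have hclosed : ∀ x y, G.Adj x y →
        (x ∈ twistCut M p q S ↔ y ∈ twistCut M p q S) := by
      intro x y hxy
      rw [← exchange_exchange (G := G) hp hq] at hxy
      rw [twistCut_mem_iff hp hq hM' S hxy]
      rw [exchange_adj] at hxy
      exact ⟨fun h => h.trans hxy.reachable, fun h => h.trans hxy.symm.reachable⟩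
    have hconst : ∀ x, x ∈ twistCut M p q S ↔ u ∈ twistCut M p q S := by
      refine hG.connected.forall_of_adj (x₀ := u) Iff.rfl fun x y hxy hx => ?_
      rw [← hclosed x y hxy, hx]
    by_cases hpq : p ∈ S ↔ q ∈ S
    · simp only [twistCut, hpq, if_true] at hconst
      exact (hconst v).mpr hu
    · have h1 := hconst p
      have h2 := hconst q
      simp only [twistCut, hpq, if_false, Set.mem_symmDiff] at h1 h2
      tauto
  · rw [← (isTree_iff_connected_and_card.mp hG).2]
    congr 1
    refine Nat.card_congr ⟨fun e => ⟨twistEdge M p q e, mem_edgeSet_exchange.mp e.2⟩,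
      fun e => ⟨twistEdge M p q e, (twistEdge_mem_edgeSet_exchange hp hq).mpr e.2⟩, ?_, ?_⟩
    · intro e
      simp [twistEdge_twistEdge hp hq]
    · intro e
      simp [twistEdge_twistEdge hp hq]

theorem degN_exchange_of_ne (hp : p ∉ M) (hq : q ∉ M) {x : V} (hxp : x ≠ p) (hxq : x ≠ q) :
    degN (G.exchange M p q) x = degN G x := by
  have hinv : Function.Involutive (fun y => twist M p q y x) :=
    fun y => twist_twist hp hq Iff.rfl
  have : (G.exchange M p q).neighborSet x = (fun y => twist M p q y x) '' G.neighborSet x := by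
    rw [hinv.image_eq_preimage_symm]
    ext y
    simp only [mem_neighborSet, exchange_adj, Set.mem_preimage, twist_of_ne hxp hxq]
  rw [degN, this, Set.ncard_image_of_injective _ hinv.injective, degN]

theorem degN_exchange_left [Finite V] (hp : p ∉ M) :
    degN (G.exchange M p q) p + (G.neighborSet p ∩ M).ncard =
      degN G p + (G.neighborSet q ∩ M).ncard := by
  have h1 : (G.exchange M p q).neighborSet p = G.neighborSet p \ M ∪ G.neighborSet q ∩ M := by
    ext y
    by_cases hy : y ∈ M
    · simp [exchange_adj, twist_left hp hy, twist_of_mem_left hy, hy]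
    · simp [exchange_adj, twist_of_notMem_right hy, twist_of_notMem_right hp, hy]
  have h2 : Disjoint (G.neighborSet p \ M) (G.neighborSet q ∩ M) := by
    rw [Set.disjoint_left]
    rintro y ⟨-, hy⟩ ⟨-, hy'⟩
    exact hy hy'
  have h3 := Set.ncard_inter_add_ncard_sdiff_eq_ncard (G.neighborSet p) M (Set.toFinite _)
  rw [degN, h1, Set.ncard_union_eq h2 (Set.toFinite _) (Set.toFinite _), degN]
  omega

theorem exchange_comm : G.exchange M p q = G.exchange M q p := by
  classical
  ext x y
  simp only [exchange_adj, twist, Equiv.swap_comm p q]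

theorem degN_exchange_right [Finite V] (hq : q ∉ M) :
    degN (G.exchange M p q) q + (G.neighborSet q ∩ M).ncard =
      degN G q + (G.neighborSet p ∩ M).ncard := by
  rw [exchange_comm]
  exact degN_exchange_left hq

end ExchangeBranches

section Improvement

variable {V : Type*} {G : SimpleGraph V} {p q : V} {A B R : Set V}

theorem Hangs.exchange_out (hA : G.Hangs p A) (hB : G.Hangs q B) :
    ∀ x y, G.Adj x y → x ∈ A ∪ B → y ∉ A ∪ B → y = p ∨ y = q := by
  intro x y hxy hx hy
  simp only [Set.mem_union, not_or] at hx hy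
  exact hx.elim (fun h => Or.inl (hA.2 hxy h hy.1)) (fun h => Or.inr (hB.2 hxy h hy.2))

/-- Exchanging a larger set `A` hanging at `p` with a smaller set `B` hanging at `q` does not
decrease any Steiner Wiener index and increases the Wiener index, provided that the part of the
tree beyond `p` in the direction of `q` is small. -/
theorem IsTree.steinerWiener_exchange [Fintype V] (hG : G.IsTree) (hpq : p ≠ q)
    (hA : G.Hangs p A) (hB : G.Hangs q B) (hqA : q ∉ A) (hpB : p ∉ B)
    (hR : G.Hangs p R) (hqR : q ∈ R) (hBA : B.ncard < A.ncard)
    (hsize : 2 * R.ncard + A.ncard < Fintype.card V + B.ncard) :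
    (∀ k, 1 ≤ k → steinerWiener G k ≤ steinerWiener (G.exchange (A ∪ B) p q) k) ∧
      steinerWiener G 2 < steinerWiener (G.exchange (A ∪ B) p q) 2 := by
  classical
  set M := A ∪ B with hMdef
  have hp : p ∉ M := fun h => h.elim hA.1 hpB
  have hq : q ∉ M := fun h => h.elim hqA hB.1
  have hM := hA.exchange_out hB
  have hG' := hG.exchange hp hq hM
  have hcut : ∀ e, ∃ c, e ∈ G.edgeSet → G.IsCut e c ∧ p ∉ c := by
    intro e
    by_cases he : e ∈ G.edgeSet
    · obtain ⟨c, hc⟩ := hG.isAcyclic.exists_isCut he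
      by_cases hpc : p ∈ c
      · exact ⟨cᶜ, fun _ => ⟨hc.compl, fun h => h hpc⟩⟩
      · exact ⟨c, fun _ => ⟨hc, hpc⟩⟩
    · exact ⟨∅, fun h => absurd h he⟩
  choose c hc using hcut
  have hsame : ∀ e ∈ G.edgeSet, q ∉ c e → twistCut M p q (c e) = c e := by
    intro e he hqc
    have := (hc e he).2
    simp [twistCut, hqc, this]
  have hdiff : ∀ e ∈ G.edgeSet, q ∈ c e → (c e).ncard < (twistCut M p q (c e)).ncard ∧
      (c e).ncard + (twistCut M p q (c e)).ncard < Fintype.card V := by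
    intro e he hqc
    obtain ⟨hce, hpc⟩ := hc e he
    have h1 : Disjoint (c e) A := hce.disjoint_hangs hG.connected hpc hqc hA hqA
    have h2 : Disjoint (c e)ᶜ B :=
      hce.compl.disjoint_hangs hG.connected (fun h => h hqc) hpc hB hpB
    have h3 : B ⊆ c e := by
      intro x hx
      by_contra h
      exact Set.disjoint_left.mp h2 h hx
    have h4 : c e ⊆ R := hce.subset_hangs hG.connected hpc hqc hR hqR
    have h5 : twistCut M p q (c e) = (c e \ B) ∪ A := by
      have : ¬(p ∈ c e ↔ q ∈ c e) := by tauto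
      simp only [twistCut, this, if_false]
      ext x
      have hx1 : x ∈ c e → x ∉ A := fun h => Set.disjoint_left.mp h1 h
      have hx3 : x ∈ B → x ∈ c e := fun h => h3 h
      simp only [Set.mem_symmDiff, hMdef, Set.mem_union, Set.mem_sdiff]
      tauto
    have h6 : (twistCut M p q (c e)).ncard = (c e \ B).ncard + A.ncard := by
      rw [h5, Set.ncard_union_eq (h1.mono_left Set.sdiff_subset) (Set.toFinite _) (Set.toFinite _)]
    have h7 := Set.ncard_sdiff_add_ncard_of_subset h3 (Set.toFinite _)
    have h8 := Set.ncard_le_ncard h4 (Set.toFinite _)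
    omega
  have hcut' : ∀ e ∈ (G.exchange M p q).edgeSet,
      (G.exchange M p q).IsCut e (twistCut M p q (c (twistEdge M p q e))) := by
    intro e he
    have := (hc _ (mem_edgeSet_exchange.mp he)).1.exchange hp hq hM
    rwa [twistEdge_twistEdge hp hq] at this
  have hsum : ∀ k, 1 ≤ k → steinerWiener (G.exchange M p q) k =
      ∑ e ∈ (Set.toFinite G.edgeSet).toFinset,
        splitCount (Fintype.card V) k (twistCut M p q (c e)).ncard := by
    intro k hk
    rw [hG'.steinerWiener_eq hk hcut']
    refine Finset.sum_nbij' (twistEdge M p q) (twistEdge M p q) ?_ ?_ ?_ ?_ ?_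
    · intro e he
      simpa [mem_edgeSet_exchange] using he
    · intro e he
      simpa [twistEdge_mem_edgeSet_exchange hp hq] using he
    · exact fun e _ => twistEdge_twistEdge hp hq e
    · exact fun e _ => twistEdge_twistEdge hp hq e
    · exact fun e _ => rfl
  have hterm : ∀ k, ∀ e ∈ (Set.toFinite G.edgeSet).toFinset,
      splitCount (Fintype.card V) k (c e).ncard ≤
        splitCount (Fintype.card V) k (twistCut M p q (c e)).ncard := by
    intro k e he
    have he' : e ∈ G.edgeSet := by simpa using he
    by_cases hqc : q ∈ c e
    · obtain ⟨h1, h2⟩ := hdiff e he' hqc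
      exact splitCount_le h1.le h2.le
    · rw [hsame e he' hqc]
  constructor
  · intro k hk
    rw [hG.steinerWiener_eq hk fun e he => (hc e he).1, hsum k hk]
    exact Finset.sum_le_sum (hterm k)
  · rw [hG.steinerWiener_eq one_le_two fun e he => (hc e he).1, hsum 2 one_le_two]
    refine Finset.sum_lt_sum (hterm 2) ?_
    obtain ⟨w, hw⟩ := (hG.connected p q).exists_isPath
    obtain ⟨e, he⟩ : ∃ e, e ∈ w.edges := by
      cases w with
      | nil => exact absurd rfl hpq
      | cons h w => exact ⟨_, by rw [Walk.edges_cons]; exact List.mem_cons_self⟩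
    have heG := w.edges_subset_edgeSet he
    have hqc : q ∈ c e := by
      have h1 := ((hc e heG).1.mem_edges_iff w hw.isTrail).mp he
      have h2 := (hc e heG).2
      tauto
    exact ⟨e, by simpa using heG, splitCount_two_lt (hdiff e heG hqc).1 (hdiff e heG hqc).2⟩

end Improvement

section Segments

variable {V W : Type*} {G : SimpleGraph V} {H : SimpleGraph W}

/-- Two edges of `G` sharing a vertex of degree two. -/
def SegmentAdj (G : SimpleGraph V) (e e' : Sym2 V) : Prop :=
  e ∈ G.edgeSet ∧ e' ∈ G.edgeSet ∧ ∃ x, degN G x = 2 ∧ x ∈ e ∧ x ∈ e'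

/-- The edges of the segment through `e`. -/
def segmentClass (G : SimpleGraph V) (e : Sym2 V) : Set (Sym2 V) :=
  {e' | Relation.ReflTransGen G.SegmentAdj e e'}

/-- The edge sets of the segments of `G`. -/
def segmentClasses (G : SimpleGraph V) : Set (Set (Sym2 V)) :=
  G.segmentClass '' G.edgeSet

theorem SegmentAdj.symm {e e' : Sym2 V} (h : G.SegmentAdj e e') : G.SegmentAdj e' e :=
  ⟨h.2.1, h.1, h.2.2.imp fun _ hx => ⟨hx.1, hx.2.2, hx.2.1⟩⟩

theorem reflTransGen_segmentAdj_symm {e e' : Sym2 V}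
    (h : Relation.ReflTransGen G.SegmentAdj e e') : Relation.ReflTransGen G.SegmentAdj e' e :=
  have : Std.Symm G.SegmentAdj := ⟨fun _ _ h => h.symm⟩
  Relation.ReflTransGen.stdSymm.symm _ _ h

theorem eq_or_eq_of_degN_eq_two {z a b y : V} (hd : degN G z = 2) (ha : G.Adj z a)
    (hb : G.Adj z b) (hab : a ≠ b) (hy : G.Adj z y) : y = a ∨ y = b := by
  have hfin : (G.neighborSet z).Finite := Set.finite_of_ncard_ne_zero (by
    unfold degN at hd; omega)
  have hsub : ({a, b} : Set V) ⊆ G.neighborSet z := by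
    rintro x (rfl | rfl)
    · exact ha
    · exact hb
  have heq := Set.eq_of_subset_of_ncard_le hsub (by
    rw [Set.ncard_pair hab]; exact hd.le) hfin
  have : y ∈ ({a, b} : Set V) := heq ▸ hy
  simpa using this

theorem Walk.IsPath.mk_mem_edges_of_degN_eq_two {u v z y : V} {w : G.Walk u v} (hw : w.IsPath)
    (hz : z ∈ w.support) (hzu : z ≠ u) (hzv : z ≠ v) (hd : degN G z = 2) (hy : G.Adj z y) :
    s(z, y) ∈ w.edges := by
  obtain ⟨p, q, rfl⟩ := Walk.mem_support_iff_exists_append.1 hz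
  have hp : ¬ p.Nil := fun h => hzu h.eq.symm
  have hq : ¬ q.Nil := fun h => hzv h.eq
  have hne : p.penultimate ≠ q.snd := by
    refine hw.ne_of_mem_support_of_append ?_ (Walk.getVert_mem_support _ _)
      (Walk.getVert_mem_support _ _)
    exact (q.adj_snd hq).ne'
  rw [Walk.edges_append, List.mem_append]
  rcases eq_or_eq_of_degN_eq_two hd (p.adj_penultimate hp).symm (q.adj_snd hq) hne hy with rfl | rfl
  · left
    rw [Sym2.eq_swap]
    exact Walk.mk_penultimate_end_mem_edges hp
  · right
    exact Walk.mk_start_snd_mem_edges hq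

theorem Walk.IsPath.reflTransGen_segmentAdj {u v : V} {w : G.Walk u v} (hw : w.IsPath)
    (hd : ∀ x ∈ w.support, x ≠ u → x ≠ v → degN G x = 2) {e : Sym2 V} (he : e ∈ w.edges) :
    Relation.ReflTransGen G.SegmentAdj s(u, w.snd) e := by
  induction w with
  | nil => simp at he
  | @cons u u' v h w ih =>
    rw [Walk.cons_isPath_iff] at hw
    rw [Walk.edges_cons, List.mem_cons] at he
    rw [Walk.snd_cons]
    rcases he with rfl | he
    · exact .refl
    have hnil : ¬ w.Nil := fun hn => by
      rw [Walk.edges_eq_nil.2 hn] at he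
      simp at he
    have hu' : u' ≠ v := by
      rintro rfl
      exact hnil (Walk.isPath_iff_nil.1 hw.1)
    refine .head ⟨h, w.adj_snd hnil, u', ?_, by simp, by simp⟩ (ih hw.1 ?_ he)
    · exact hd u' (by simp) h.ne' hu'
    · intro x hx hxu hxv
      exact hd x (by simp [hx]) (fun hxu => hw.2 (hxu ▸ hx)) hxv

theorem Walk.IsPath.segmentClass_eq {u v : V} {w : G.Walk u v} (hw : w.IsPath)
    (hd : ∀ x ∈ w.support, x ≠ u → x ≠ v → degN G x = 2) (hu : degN G u ≠ 2) (hv : degN G v ≠ 2)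
    {e : Sym2 V} (he : e ∈ w.edges) : G.segmentClass e = {e' | e' ∈ w.edges} := by
  ext e'
  constructor
  · intro (h : Relation.ReflTransGen _ _ _)
    induction h with
    | refl => exact he
    | tail _ h ih =>
      obtain ⟨-, h2, x, hx, hx1, hx2⟩ := h
      obtain ⟨y, rfl⟩ := hx2
      have hxs := Walk.mem_support_of_mem_edges ih hx1
      exact hw.mk_mem_edges_of_degN_eq_two hxs (fun h => hu (h ▸ hx)) (fun h => hv (h ▸ hx)) hx h2
  · intro he'
    exact (reflTransGen_segmentAdj_symm (hw.reflTransGen_segmentAdj hd he)).trans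
      (hw.reflTransGen_segmentAdj hd he')

theorem degN_ne_two_iff [Finite V] {u a : V} (ha : G.Adj u a) :
    degN G u ≠ 2 ↔ IsLeafV G u ∨ IsBranchV G u := by
  have : 0 < degN G u := (Set.ncard_pos (Set.toFinite _)).2 ⟨a, ha⟩
  unfold IsLeafV IsBranchV
  omega

theorem Walk.adj_start_of_mem_edges {u v : V} {w : G.Walk u v} {e : Sym2 V} (he : e ∈ w.edges) :
    ∃ a, G.Adj u a := by
  cases w with
  | nil => simp at he
  | cons h _ => exact ⟨_, h⟩

theorem Walk.IsPath.ne_of_mem_edges {u v : V} {w : G.Walk u v} (hw : w.IsPath) {e : Sym2 V}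
    (he : e ∈ w.edges) : u ≠ v := by
  rintro rfl
  rw [Walk.edges_eq_nil.2 (Walk.isPath_iff_nil.1 hw)] at he
  simp at he

/-- Every edge of a finite tree lies on a segment. -/
theorem IsAcyclic.exists_segment [Finite V] (hG : G.IsAcyclic) {e : Sym2 V} (he : e ∈ G.edgeSet) :
    ∃ (u v : V) (w : G.Walk u v), w.IsPath ∧ e ∈ w.edges ∧
      (∀ x ∈ w.support, x ≠ u → x ≠ v → degN G x = 2) ∧ degN G u ≠ 2 ∧ degN G v ≠ 2 := by
  cases nonempty_fintype V
  classical
  let P : ℕ → Prop := fun n => ∃ (u v : V) (w : G.Walk u v), w.IsPath ∧ e ∈ w.edges ∧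
    (∀ x ∈ w.support, x ≠ u → x ≠ v → degN G x = 2) ∧ w.length = n
  have h1 : P 1 := by
    induction e with
    | _ a b =>
    have hab : G.Adj a b := he
    refine ⟨a, b, hab.toWalk, by simp [Walk.isPath_def, hab.ne], by simp, ?_, by simp⟩
    intro x hx hxa hxb
    simp at hx
    tauto
  have hb : ∀ n, P n → n ≤ Fintype.card V := by
    rintro n ⟨u, v, w, hw, -, -, rfl⟩
    exact hw.length_lt.le
  have hmax : P (Nat.findGreatest P (Fintype.card V)) :=
    Nat.findGreatest_spec (hb 1 h1) h1
  have key : ∀ {u v : V} (w : G.Walk u v), w.IsPath → e ∈ w.edges →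
      (∀ x ∈ w.support, x ≠ u → x ≠ v → degN G x = 2) →
      w.length = Nat.findGreatest P (Fintype.card V) → degN G v ≠ 2 := by
    intro u v w hw hew hd hl hv
    have hnil : ¬ w.Nil := fun hn => hw.ne_of_mem_edges hew hn.eq
    obtain ⟨b, hb1, hb2⟩ : ∃ b ∈ G.neighborSet v, b ≠ w.penultimate :=
      Set.exists_ne_of_one_lt_ncard (by unfold degN at hv; omega) _
    rw [mem_neighborSet] at hb1
    have hbs : b ∉ w.support := fun hbs =>
      hb2 (hG.eq_penultimate_of_adj_end hw hb1 hbs)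
    have : P (w.length + 1) := by
      refine ⟨u, b, w.concat hb1, hw.concat hbs hb1, by simp [Walk.edges_concat, hew], ?_, by simp⟩
      intro x hx hxu hxb
      rw [Walk.support_concat, List.mem_append, List.mem_singleton] at hx
      rcases hx with hx | hx
      · by_cases hxv : x = v
        · exact hxv ▸ hv
        · exact hd x hx hxu hxv
      · exact absurd hx hxb
    have := Nat.le_findGreatest (hb _ this) this
    omega
  obtain ⟨u, v, w, hw, hew, hd, hl⟩ := hmax
  refine ⟨u, v, w, hw, hew, hd, ?_, key w hw hew hd hl⟩
  refine key w.reverse hw.reverse (by simpa using hew) ?_ (by simpa using hl)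
  intro x hx hxv hxu
  exact hd x (by simpa using hx) hxu hxv

theorem IsAcyclic.eq_of_isPath (hG : G.IsAcyclic) {u v : V} {w w' : G.Walk u v} (hw : w.IsPath)
    (hw' : w'.IsPath) : w = w' :=
  congrArg Subtype.val ((hG.subsingleton_path u v).elim ⟨w, hw⟩ ⟨w', hw'⟩)

/-- The edges on a path joining the two ends of `z`. -/
def pathEdges (G : SimpleGraph V) (z : Sym2 V) : Set (Sym2 V) :=
  {e | ∃ (u v : V) (w : G.Walk u v), z = s(u, v) ∧ w.IsPath ∧ e ∈ w.edges}

theorem IsAcyclic.pathEdges_mk (hG : G.IsAcyclic) {u v : V} {w : G.Walk u v} (hw : w.IsPath) :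
    G.pathEdges s(u, v) = {e | e ∈ w.edges} := by
  ext e
  constructor
  · rintro ⟨u', v', w', h, hw', he⟩
    rcases Sym2.eq_iff.1 h with ⟨rfl, rfl⟩ | ⟨rfl, rfl⟩
    · rwa [← hG.eq_of_isPath hw' hw]
    · rw [← hG.eq_of_isPath hw'.reverse hw]
      simpa using he
  · intro he
    exact ⟨u, v, w, rfl, hw, he⟩

theorem IsTree.length_eq_dist (hG : G.IsTree) {u v : V} {w : G.Walk u v} (hw : w.IsPath) :
    w.length = G.dist u v := by
  obtain ⟨w', hw', h⟩ := hG.connected.exists_path_of_dist u v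
  rw [← h, hG.isAcyclic.eq_of_isPath hw hw']

theorem IsSegment.degN_left_ne {u v : V} (h : IsSegment G u v) : degN G u ≠ 2 := by
  have := h.2.1
  unfold IsLeafV IsBranchV at this
  omega

theorem IsSegment.degN_right_ne {u v : V} (h : IsSegment G u v) : degN G v ≠ 2 := by
  have := h.2.2.1
  unfold IsLeafV IsBranchV at this
  omega

theorem Walk.ncard_edges {u v : V} {w : G.Walk u v} (hw : w.IsPath) :
    {e | e ∈ w.edges}.ncard = w.length := by
  classical
  have : {e | e ∈ w.edges} = (w.edges.toFinset : Set (Sym2 V)) := by ext; simp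
  rw [this, Set.ncard_coe_finset, List.toFinset_card_of_nodup hw.isTrail.edges_nodup,
    Walk.length_edges]

theorem IsTree.segmentMultiset_eq [Fintype V] (hG : G.IsTree) :
    segmentMultiset G = (Set.toFinite G.segmentClasses).toFinset.val.map Set.ncard := by
  classical
  unfold segmentMultiset
  set S : Set (Sym2 V) := {e | ∃ u v, e = s(u, v) ∧ IsSegment G u v} with hS
  have himg : G.pathEdges '' S = G.segmentClasses := by
    ext c
    constructor
    · rintro ⟨z, ⟨u, v, rfl, h⟩, rfl⟩
      obtain ⟨hne, hu, hv, w, hw, hd⟩ := h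
      have hnil : ¬ w.Nil := fun hn => hne hn.eq
      have hmem := Walk.mk_start_snd_mem_edges hnil
      refine ⟨s(u, w.snd), w.adj_snd hnil, ?_⟩
      rw [hG.isAcyclic.pathEdges_mk hw]
      exact hw.segmentClass_eq hd (IsSegment.degN_left_ne ⟨hne, hu, hv, w, hw, hd⟩)
        (IsSegment.degN_right_ne ⟨hne, hu, hv, w, hw, hd⟩) hmem
    · rintro ⟨e, he, rfl⟩
      obtain ⟨u, v, w, hw, hew, hd, hu, hv⟩ := hG.isAcyclic.exists_segment he
      refine ⟨s(u, v), ⟨u, v, rfl, hw.ne_of_mem_edges hew, ?_, ?_, w, hw, hd⟩, ?_⟩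
      · obtain ⟨a, ha⟩ := Walk.adj_start_of_mem_edges hew
        exact (degN_ne_two_iff ha).1 hu
      · obtain ⟨a, ha⟩ := Walk.adj_start_of_mem_edges (w := w.reverse) (e := e) (by simpa using hew)
        exact (degN_ne_two_iff ha).1 hv
      · rw [hG.isAcyclic.pathEdges_mk hw, hw.segmentClass_eq hd hu hv hew]
  have hends : ∀ {u v : V}, IsSegment G u v →
      ∀ x, (∃ e ∈ G.pathEdges s(u, v), x ∈ e) ∧ degN G x ≠ 2 ↔ x ∈ s(u, v) := by
    intro u v h x
    obtain ⟨hne, hu, hv, w, hw, hd⟩ := id h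
    have hnil : ¬ w.Nil := fun hn => hne hn.eq
    rw [hG.isAcyclic.pathEdges_mk hw, Sym2.mem_iff]
    have : (∃ e ∈ {e | e ∈ w.edges}, x ∈ e) ↔ x ∈ w.support :=
      (Walk.mem_support_iff_exists_mem_edges_of_not_nil hnil).symm
    rw [this]
    constructor
    · rintro ⟨h1, h2⟩
      by_contra hc
      push Not at hc
      exact h2 (hd x h1 hc.1 hc.2)
    · rintro (rfl | rfl)
      · exact ⟨by simp, h.degN_left_ne⟩
      · exact ⟨by simp, h.degN_right_ne⟩
  have hinj : Set.InjOn G.pathEdges S := by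
    rintro z ⟨u, v, rfl, h⟩ z' ⟨u', v', rfl, h'⟩ heq
    ext x
    rw [← hends h, ← hends h', heq]
  have hfin : (Set.toFinite G.segmentClasses).toFinset
      = (Set.toFinite S).toFinset.image G.pathEdges := by
    ext c
    simp only [Set.Finite.mem_toFinset, Finset.mem_image]
    rw [← himg]
    simp
  rw [hfin, Finset.image_val_of_injOn (by simpa using hinj), Multiset.map_map]
  refine Multiset.map_congr rfl ?_
  intro z hz
  have hz' : z ∈ S := (Set.toFinite S).mem_toFinset.1 hz
  obtain ⟨u, v, rfl, h⟩ := hz'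
  obtain ⟨hne, hu, hv, w, hw, hd⟩ := id h
  simp only [Sym2.lift_mk, Function.comp]
  rw [hG.isAcyclic.pathEdges_mk hw, Walk.ncard_edges hw, hG.length_eq_dist hw]

theorem segmentMultiset_eq_of_equiv [Fintype V] [Fintype W] (hG : G.IsTree) (hH : H.IsTree)
    (f : Sym2 V ≃ Sym2 W) (hf : ∀ e, f e ∈ H.edgeSet ↔ e ∈ G.edgeSet)
    (hadj : ∀ e e', H.SegmentAdj (f e) (f e') ↔ G.SegmentAdj e e') :
    segmentMultiset H = segmentMultiset G := by
  classical
  have hclass : ∀ e, H.segmentClass (f e) = f '' G.segmentClass e := by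
    intro e
    ext e'
    constructor
    · intro (h : Relation.ReflTransGen _ _ _)
      refine ⟨f.symm e', ?_, f.apply_symm_apply e'⟩
      have := Relation.ReflTransGen.lift (p := G.SegmentAdj) f.symm
        (fun a b hab => (hadj _ _).1 (by simpa using hab)) _ _ h
      rwa [Function.onFun, f.symm_apply_apply] at this
    · rintro ⟨e', h, rfl⟩
      exact Relation.ReflTransGen.lift f (fun a b hab => (hadj a b).2 hab) _ _ h
  have himg : H.segmentClasses = (fun c => f '' c) '' G.segmentClasses := by
    ext c
    constructor
    · rintro ⟨e, he, rfl⟩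
      obtain ⟨e, rfl⟩ := f.surjective e
      exact ⟨_, ⟨e, (hf e).1 he, rfl⟩, (hclass e).symm⟩
    · rintro ⟨_, ⟨e, he, rfl⟩, rfl⟩
      exact ⟨f e, (hf e).2 he, hclass e⟩
  have hfin : (Set.toFinite H.segmentClasses).toFinset
      = (Set.toFinite G.segmentClasses).toFinset.image (fun c => f '' c) := by
    ext c
    simp only [Set.Finite.mem_toFinset, Finset.mem_image]
    rw [himg]
    simp
  rw [hG.segmentMultiset_eq, hH.segmentMultiset_eq, hfin,
    Finset.image_val_of_injOn f.injective.image_injective.injOn, Multiset.map_map]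
  exact Multiset.map_congr rfl fun c _ => Set.ncard_image_of_injective c f.injective

theorem mem_twistEdge_iff {M : Set V} {p q x : V} (hp : x ≠ p) (hq : x ≠ q) (e : Sym2 V) :
    x ∈ twistEdge M p q e ↔ x ∈ e := by
  classical
  have key : ∀ a b, x = twist M p q a b ↔ x = a := by
    intro a b
    unfold twist
    split_ifs with h
    · rw [eq_comm, Equiv.swap_apply_eq_iff, Equiv.swap_apply_of_ne_of_ne hp hq, eq_comm]
    · exact Iff.rfl
  induction e with
  | h a b => rw [twistEdge_mk, Sym2.mem_iff, Sym2.mem_iff, key, key]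

theorem segmentMultiset_exchange [Fintype V] {M : Set V} {p q : V} (hG : G.IsTree)
    (hG' : (G.exchange M p q).IsTree) (hp : p ∉ M) (hq : q ∉ M)
    (hdp : degN G p ≠ 2) (hdq : degN G q ≠ 2)
    (hdp' : degN (G.exchange M p q) p ≠ 2) (hdq' : degN (G.exchange M p q) q ≠ 2) :
    segmentMultiset (G.exchange M p q) = segmentMultiset G := by
  refine segmentMultiset_eq_of_equiv hG hG'
    (Function.Involutive.toPerm (twistEdge M p q) (twistEdge_twistEdge hp hq))
    (fun e => twistEdge_mem_edgeSet_exchange hp hq) ?_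
  intro e e'
  change SegmentAdj _ (twistEdge M p q e) (twistEdge M p q e') ↔ _
  simp only [SegmentAdj, twistEdge_mem_edgeSet_exchange hp hq]
  refine and_congr_right' (and_congr_right' (exists_congr fun x => ?_))
  by_cases hxp : x = p
  · simp [hxp, hdp, hdp']
  by_cases hxq : x = q
  · simp [hxq, hdq, hdq']
  rw [degN_exchange_of_ne hp hq hxp hxq, mem_twistEdge_iff hxp hxq, mem_twistEdge_iff hxp hxq]

theorem degN_iso (f : G ≃g H) (x : V) : degN H (f x) = degN G x := by
  have : H.neighborSet (f x) = f '' G.neighborSet x := by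
    ext y
    obtain ⟨y, rfl⟩ := f.surjective y
    rw [f.injective.mem_set_image]
    exact f.map_adj_iff
  unfold degN
  rw [this, Set.ncard_image_of_injective _ f.injective]

/-- The action of a graph isomorphism on unordered pairs of vertices. -/
def Iso.sym2Equiv (f : G ≃g H) : Sym2 V ≃ Sym2 W where
  toFun := Sym2.map f
  invFun := Sym2.map f.symm
  left_inv e := by
    induction e with
    | h x y => simp
  right_inv e := by
    induction e with
    | h x y => simp

theorem Iso.sym2Equiv_mk (f : G ≃g H) (x y : V) : f.sym2Equiv s(x, y) = s(f x, f y) := rfl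

theorem Iso.sym2Equiv_mem_edgeSet (f : G ≃g H) (e : Sym2 V) :
    f.sym2Equiv e ∈ H.edgeSet ↔ e ∈ G.edgeSet := by
  induction e with
  | h x y => exact f.map_adj_iff

theorem Iso.apply_mem_sym2Equiv (f : G ≃g H) (x : V) (e : Sym2 V) :
    f x ∈ f.sym2Equiv e ↔ x ∈ e := by
  induction e with
  | h a b => simp [Iso.sym2Equiv_mk, f.injective.eq_iff]

theorem segmentMultiset_iso [Fintype V] [Fintype W] (hG : G.IsTree) (f : G ≃g H) :
    segmentMultiset H = segmentMultiset G := by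
  refine segmentMultiset_eq_of_equiv hG (f.isTree_iff.1 hG) f.sym2Equiv
    f.sym2Equiv_mem_edgeSet ?_
  intro e e'
  simp only [SegmentAdj, f.sym2Equiv_mem_edgeSet, f.surjective.exists, f.apply_mem_sym2Equiv,
    degN_iso]

theorem IsTree.steinerWiener_iso [Fintype V] [Fintype W] (hG : G.IsTree) (f : G ≃g H) {k : ℕ}
    (hk : 1 ≤ k) : steinerWiener H k = steinerWiener G k := by
  have hH : H.IsTree := f.isTree_iff.1 hG
  choose! c hc using fun e (he : e ∈ G.edgeSet) => hG.isAcyclic.exists_isCut he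
  have hc' : ∀ e ∈ H.edgeSet, H.IsCut e (f '' c (f.sym2Equiv.symm e)) := by
    intro e he x y hxy
    obtain ⟨x, rfl⟩ := f.surjective x
    obtain ⟨y, rfl⟩ := f.surjective y
    obtain ⟨e, rfl⟩ := f.sym2Equiv.surjective e
    rw [Equiv.symm_apply_apply, f.injective.mem_set_image, f.injective.mem_set_image,
      ← hc e ((f.sym2Equiv_mem_edgeSet e).1 he) (f.map_adj_iff.1 hxy), ← f.sym2Equiv_mk,
      f.sym2Equiv.injective.eq_iff]
  rw [hG.steinerWiener_eq hk hc, hH.steinerWiener_eq hk hc']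
  refine (Finset.sum_equiv f.sym2Equiv (fun e => ?_) fun e _ => ?_).symm
  · rw [Set.Finite.mem_toFinset, Set.Finite.mem_toFinset, f.sym2Equiv_mem_edgeSet]
  · rw [Equiv.symm_apply_apply, Set.ncard_image_of_injective _ f.injective,
      Fintype.card_congr f.toEquiv]

theorem IsTree.sum_segmentMultiset [Fintype V] (hG : G.IsTree) :
    (segmentMultiset G).sum + 1 = Fintype.card V := by
  classical
  have hmaps : ∀ e ∈ G.edgeFinset,
      G.segmentClass e ∈ (Set.toFinite G.segmentClasses).toFinset := by
    intro e he
    rw [Set.Finite.mem_toFinset]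
    exact ⟨e, mem_edgeFinset.1 he, rfl⟩
  rw [← hG.card_edgeFinset, hG.segmentMultiset_eq, Finset.card_eq_sum_card_fiberwise hmaps]
  refine congrArg (· + 1) (Finset.sum_congr rfl fun c hc => ?_)
  rw [Set.Finite.mem_toFinset] at hc
  obtain ⟨e, he, rfl⟩ := hc
  rw [← Set.ncard_coe_finset]
  congr 1
  ext e'
  rw [Finset.mem_coe, Finset.mem_filter, mem_edgeFinset]
  constructor
  · intro (h : Relation.ReflTransGen _ _ _)
    refine ⟨?_, Set.ext fun e'' =>
      ⟨fun h' => h.trans h', fun h' => (reflTransGen_segmentAdj_symm h).trans h'⟩⟩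
    cases h with
    | refl => exact he
    | tail _ h => exact h.2.1
  · rintro ⟨-, h⟩
    rw [← h]
    exact Relation.ReflTransGen.refl

/-- A tree with at least two segments has a branch vertex. -/
theorem IsTree.exists_isBranchV [Fintype V] (hG : G.IsTree)
    (h : 1 < Multiset.card (segmentMultiset G)) : ∃ x, IsBranchV G x := by
  by_contra! hno
  rw [hG.segmentMultiset_eq, Multiset.card_map, Finset.card_val, Finset.one_lt_card] at h
  obtain ⟨c₁, hc₁, c₂, hc₂, hne⟩ := h
  rw [Set.Finite.mem_toFinset] at hc₁ hc₂
  obtain ⟨e₁, he₁, rfl⟩ := hc₁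
  obtain ⟨e₂, he₂, rfl⟩ := hc₂
  have hlink : ∀ x e e', e ∈ G.edgeSet → e' ∈ G.edgeSet → x ∈ e → x ∈ e' →
      Relation.ReflTransGen G.SegmentAdj e e' := by
    intro x e e' he he' hx hx'
    by_cases heq : e = e'
    · exact heq ▸ .refl
    obtain ⟨y, rfl⟩ := hx
    obtain ⟨z, rfl⟩ := hx'
    have hyz : y ≠ z := fun h => heq (h ▸ rfl)
    have : 1 < degN G x :=
      (Set.one_lt_ncard (Set.toFinite _)).2 ⟨y, he, z, he', hyz⟩
    have := hno x
    unfold IsBranchV at this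
    exact .single ⟨he, he', x, by omega, by simp, by simp⟩
  have hall : ∀ x e, e ∈ G.edgeSet → x ∈ e → Relation.ReflTransGen G.SegmentAdj e₁ e := by
    obtain ⟨x₀, hx₀⟩ : ∃ x, x ∈ e₁ := ⟨_, e₁.out_fst_mem⟩
    refine hG.connected.forall_of_adj (x₀ := x₀) ?_ ?_
    · intro e he hx
      exact hlink x₀ _ _ he₁ he hx₀ hx
    · intro x y hxy hx e he hy
      exact (hx s(x, y) hxy (by simp)).trans (hlink y _ _ hxy he (by simp) hy)
  have h12 := hall _ e₂ he₂ e₂.out_fst_mem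
  refine hne (Set.ext fun e => ⟨fun h => ?_, fun h => h12.trans h⟩)
  exact (reflTransGen_segmentAdj_symm h12).trans h

end Segments

section Maximizers

variable {V : Type*} {G : SimpleGraph V}

theorem Hangs.inter_neighborSet_eq_empty {p q : V} {A : Set V} (hA : G.Hangs p A) (hpq : p ≠ q)
    (hq : q ∉ A) : G.neighborSet q ∩ A = ∅ := by
  rw [Set.eq_empty_iff_forall_notMem]
  rintro x ⟨hqx, hx⟩
  exact hpq (hA.2 hqx.symm hx hq).symm

theorem IsTree.ncard_neighborSet_inter_branchAt (hG : G.IsTree) {p a : V} (ha : G.Adj p a) :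
    (G.neighborSet p ∩ G.branchAt p a).ncard = 1 := by
  rw [Set.ncard_eq_one]
  refine ⟨a, Set.ext fun x => ⟨fun hx => (hG.mem_branchAt_iff_eq ha hx.1).1 hx.2, ?_⟩⟩
  rintro rfl
  exact ⟨ha, right_mem_branchAt⟩

theorem Hangs.ncard_add_three_lt [Fintype V] {p : V} {A B C : Set V} (hA : G.Hangs p A)
    (hB : G.Hangs p B) (hC : G.Hangs p C) (hAB : Disjoint A B) (hAC : Disjoint A C)
    (hBC : Disjoint B C) : A.ncard + B.ncard + C.ncard < Fintype.card V := by
  rw [← Set.ncard_union_eq hAB, ← Set.ncard_union_eq (Set.disjoint_union_left.2 ⟨hAC, hBC⟩),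
    ← Nat.card_eq_fintype_card, ← Set.ncard_univ]
  refine Set.ncard_lt_ncard (Set.ssubset_univ_iff.2 fun h => ?_)
  have hp : p ∈ A ∪ B ∪ C := h ▸ Set.mem_univ p
  exact hp.elim (fun h => h.elim hA.1 hB.1) hC.1

theorem IsTree.exists_adj_notMem_branchAt [Finite V] (hG : G.IsTree) {p y : V}
    (hy : 2 ≤ degN G y) : ∃ b, G.Adj y b ∧ p ∉ G.branchAt y b := by
  obtain ⟨b, hb, c, hc, hbc⟩ := (Set.one_lt_ncard (Set.toFinite _)).1 hy
  by_contra! h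
  exact Set.disjoint_left.1 (hG.disjoint_branchAt hb hc hbc) (h b hb) (h c hc)

theorem IsTree.exists_leaf_mem_branchAt [Finite V] (hG : G.IsTree) {p a : V} (ha : G.Adj p a) :
    ∃ q ∈ G.branchAt p a, degN G q = 1 := by
  induction hn : (G.branchAt p a).ncard using Nat.strong_induction_on generalizing p a with
  | _ n ih =>
  have hpos : 0 < degN G a := (Set.ncard_pos (Set.toFinite _)).2 ⟨p, ha.symm⟩
  by_cases h1 : degN G a = 1
  · exact ⟨a, right_mem_branchAt, h1⟩
  obtain ⟨b, hb, hpb⟩ := hG.exists_adj_notMem_branchAt (p := p) (y := a) (by omega)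
  have hsub := hG.branchAt_subset ha hb right_mem_branchAt hpb
  have hlt : (G.branchAt a b).ncard < n := by
    rw [← hn]
    exact Set.ncard_lt_ncard ⟨fun x hx => (hsub hx).1, fun h => (hsub (h right_mem_branchAt)).2 rfl⟩
  obtain ⟨q, hq, hq1⟩ := ih _ hlt hb rfl
  exact ⟨q, (hsub hq).1, hq1⟩

/-- A tree is lexicographically maximal for its Steiner `k`-Wiener index and its Steiner
`2`-Wiener index, among the trees with the same segment sequence. -/
def IsLexMaximal [Fintype V] (G : SimpleGraph V) (k : ℕ) : Prop :=
  G.IsTree ∧ ∀ G' : SimpleGraph V, G'.IsTree → segmentMultiset G' = segmentMultiset G →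
    steinerWiener G k ≤ steinerWiener G' k → steinerWiener G' 2 ≤ steinerWiener G 2

namespace IsLexMaximal

variable [Fintype V] {k : ℕ}

theorem not_exchange (hG : G.IsLexMaximal k) (hk : 1 ≤ k) {p q : V} {A B R : Set V}
    (hpq : p ≠ q) (hA : G.Hangs p A) (hB : G.Hangs q B) (hqA : q ∉ A) (hpB : p ∉ B)
    (hR : G.Hangs p R) (hqR : q ∈ R) (hBA : B.ncard < A.ncard)
    (hsize : 2 * R.ncard + A.ncard < Fintype.card V + B.ncard)
    (hp : degN G p ≠ 2) (hq : degN G q ≠ 2)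
    (hp' : degN G p + (G.neighborSet q ∩ B).ncard ≠ 2 + (G.neighborSet p ∩ A).ncard)
    (hq' : degN G q + (G.neighborSet p ∩ A).ncard ≠ 2 + (G.neighborSet q ∩ B).ncard) : False := by
  have hpM : p ∉ A ∪ B := fun h => h.elim hA.1 hpB
  have hqM : q ∉ A ∪ B := fun h => h.elim hqA hB.1
  have htree := hG.1.exchange hpM hqM (hA.exchange_out hB)
  have hNp : G.neighborSet p ∩ (A ∪ B) = G.neighborSet p ∩ A := by
    rw [Set.inter_union_distrib_left, hB.inter_neighborSet_eq_empty hpq.symm hpB, Set.union_empty]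
  have hNq : G.neighborSet q ∩ (A ∪ B) = G.neighborSet q ∩ B := by
    rw [Set.inter_union_distrib_left, hA.inter_neighborSet_eq_empty hpq hqA, Set.empty_union]
  have h1 := degN_exchange_left (G := G) (q := q) hpM
  have h2 := degN_exchange_right (G := G) (p := p) hqM
  rw [hNp, hNq] at h1 h2
  have hseg := segmentMultiset_exchange hG.1 htree hpM hqM hp hq (by omega) (by omega)
  have hSW := hG.1.steinerWiener_exchange hpq hA hB hqA hpB hR hqR hBA hsize
  exact (hG.2 _ htree hseg (hSW.1 k hk)).not_gt hSW.2

theorem degN_le_four (hG : G.IsLexMaximal k) (hk : 1 ≤ k) (x : V) : degN G x ≤ 4 := by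
  by_contra! hx
  have key : ∀ a b c d, G.Adj x a → G.Adj x b → G.Adj x c → G.Adj x d → a ≠ b → a ≠ c → a ≠ d →
      b ≠ c → b ≠ d → c ≠ d → (G.branchAt x a).ncard ≤ (G.branchAt x b).ncard → False := by
    intro a b c d ha hb hc hd hab hac had hbc hbd hcd hle
    have hh := fun {y} (hy : G.Adj x y) => hG.1.isAcyclic.hangs_branchAt hy
    obtain ⟨q, hq, hq1⟩ := hG.1.exists_leaf_mem_branchAt ha
    have hdA : Disjoint (G.branchAt x a) (G.branchAt x c ∪ G.branchAt x d) :=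
      Set.disjoint_union_right.2
        ⟨hG.1.disjoint_branchAt ha hc hac, hG.1.disjoint_branchAt ha hd had⟩
    have hdB : Disjoint (G.branchAt x b) (G.branchAt x c ∪ G.branchAt x d) :=
      Set.disjoint_union_right.2
        ⟨hG.1.disjoint_branchAt hb hc hbc, hG.1.disjoint_branchAt hb hd hbd⟩
    have hA := (hh hc).union (hh hd)
    have hcard := Hangs.ncard_add_three_lt (hh ha) (hh hb) hA
      (hG.1.disjoint_branchAt ha hb hab) hdA hdB
    have hN : (G.neighborSet x ∩ (G.branchAt x c ∪ G.branchAt x d)).ncard = 2 := by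
      rw [Set.inter_union_distrib_left, Set.ncard_union_eq,
        hG.1.ncard_neighborSet_inter_branchAt hc, hG.1.ncard_neighborSet_inter_branchAt hd]
      exact (hG.1.disjoint_branchAt hc hd hcd).mono Set.inter_subset_right Set.inter_subset_right
    refine hG.not_exchange hk (p := x) (q := q) (B := ∅) ?_ hA ⟨by simp, by simp⟩
      (Set.disjoint_left.1 hdA hq) (by simp) (hh ha) hq ?_ ?_ (by omega) (by omega) ?_ ?_
    · rintro rfl
      exact (hh ha).1 hq
    · rw [Set.ncard_empty, Set.ncard_pos]
      exact ⟨c, .inl right_mem_branchAt⟩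
    · rw [Set.ncard_empty]
      omega
    · rw [hN, Set.inter_empty, Set.ncard_empty]
      omega
    · rw [hN, Set.inter_empty, Set.ncard_empty]
      omega
  obtain ⟨s, hs, hs4⟩ := Set.exists_subset_card_eq (s := G.neighborSet x) (n := 4) hx.le
  obtain ⟨a, b, c, d, hab, hac, had, hbc, hbd, hcd, rfl⟩ := Set.ncard_eq_four.1 hs4
  have ha : G.Adj x a := hs (by simp)
  have hb : G.Adj x b := hs (by simp)
  have hc : G.Adj x c := hs (by simp)
  have hd : G.Adj x d := hs (by simp)
  rcases le_total (G.branchAt x a).ncard (G.branchAt x b).ncard with hle | hle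
  · exact key a b c d ha hb hc hd hab hac had hbc hbd hcd hle
  · exact key b a c d hb ha hc hd hab.symm hbc hbd hac had hcd hle

theorem degN_ne_four (hG : G.IsLexMaximal k) (hk : 1 ≤ k) {x a b y z : V} (ha : G.Adj x a)
    (hb : G.Adj x b) (hab : a ≠ b) (hy : IsBranchV G y) (hya : y ∈ G.branchAt x a)
    (hz : IsBranchV G z) (hzb : z ∈ G.branchAt x b) : degN G x ≠ 4 := by
  intro hx
  have key : ∀ a b y, G.Adj x a → G.Adj x b → a ≠ b → IsBranchV G y → y ∈ G.branchAt x a →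
      (G.branchAt x a).ncard ≤ (G.branchAt x b).ncard → False := by
    intro a b y ha hb hab hy hya hle
    have hh := fun {y} (hy : G.Adj x y) => hG.1.isAcyclic.hangs_branchAt hy
    obtain ⟨c, hc, hcab⟩ : ∃ c ∈ G.neighborSet x, c ∉ ({a, b} : Set V) := by
      refine Set.exists_mem_notMem_of_ncard_lt_ncard ?_
      rw [Set.ncard_pair hab]
      unfold degN at hx
      omega
    rw [mem_neighborSet] at hc
    simp only [Set.mem_insert_iff, Set.mem_singleton_iff, not_or] at hcab
    have hac := hG.1.disjoint_branchAt ha hc (Ne.symm hcab.1)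
    have hcard := Hangs.ncard_add_three_lt (hh ha) (hh hb) (hh hc)
      (hG.1.disjoint_branchAt ha hb hab) hac (hG.1.disjoint_branchAt hb hc (Ne.symm hcab.2))
    have hN := hG.1.ncard_neighborSet_inter_branchAt hc
    unfold IsBranchV at hy
    refine hG.not_exchange hk (p := x) (q := y) (B := ∅) ?_ (hh hc) ⟨by simp, by simp⟩
      (Set.disjoint_left.1 hac hya) (by simp) (hh ha) hya ?_ ?_ (by omega) (by omega) ?_ ?_
    · rintro rfl
      exact (hh ha).1 hya
    · rw [Set.ncard_empty, Set.ncard_pos]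
      exact ⟨c, right_mem_branchAt⟩
    · rw [Set.ncard_empty]
      omega
    · rw [hN, Set.inter_empty, Set.ncard_empty]
      omega
    · rw [hN, Set.inter_empty, Set.ncard_empty]
      omega
  rcases le_total (G.branchAt x a).ncard (G.branchAt x b).ncard with hle | hle
  · exact key a b y ha hb hab hy hya hle
  · exact key b a z hb ha hab.symm hz hzb hle

theorem not_three_branches (hG : G.IsLexMaximal k) (hk : 1 ≤ k) {x a b c y z t : V}
    (ha : G.Adj x a) (hb : G.Adj x b) (hc : G.Adj x c) (hab : a ≠ b) (hac : a ≠ c) (hbc : b ≠ c)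
    (hy : IsBranchV G y) (hya : y ∈ G.branchAt x a) (hz : IsBranchV G z)
    (hzb : z ∈ G.branchAt x b) (ht : IsBranchV G t) (htc : t ∈ G.branchAt x c) : False := by
  have hx : 3 ≤ degN G x := by
    have hsub : ({a, b, c} : Set V) ⊆ G.neighborSet x := by
      rintro v (rfl | rfl | rfl) <;> assumption
    have := Set.ncard_le_ncard hsub
    rwa [Set.ncard_eq_three.2 ⟨a, b, c, hab, hac, hbc, rfl⟩] at this
  have key : ∀ a b c y, G.Adj x a → G.Adj x b → G.Adj x c → a ≠ b → a ≠ c → b ≠ c →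
      IsBranchV G y → y ∈ G.branchAt x a → (G.branchAt x a).ncard ≤ (G.branchAt x b).ncard →
      (G.branchAt x a).ncard ≤ (G.branchAt x c).ncard → False := by
    intro a b c y ha hb hc hab hac hbc hy hya hleb hlec
    have hh := fun {x y} (hy : G.Adj x y) => hG.1.isAcyclic.hangs_branchAt hy
    have hdab := hG.1.disjoint_branchAt ha hb hab
    have hcard := Hangs.ncard_add_three_lt (hh ha) (hh hb) (hh hc) hdab
      (hG.1.disjoint_branchAt ha hc hac) (hG.1.disjoint_branchAt hb hc hbc)
    unfold IsBranchV at hy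
    obtain ⟨d, hd, hxd⟩ := hG.1.exists_adj_notMem_branchAt (p := x) (y := y) (by omega)
    have hsub := hG.1.branchAt_subset ha hd hya hxd
    have hlt : (G.branchAt y d).ncard < (G.branchAt x a).ncard :=
      Set.ncard_lt_ncard ⟨fun v hv => (hsub hv).1, fun h => (hsub (h hya)).2 rfl⟩
    have hNb := hG.1.ncard_neighborSet_inter_branchAt hb
    have hNd := hG.1.ncard_neighborSet_inter_branchAt hd
    refine hG.not_exchange hk (p := x) (q := y) ?_ (hh hb) (hh hd)
      (Set.disjoint_left.1 hdab hya) hxd (hh ha) hya (by omega) (by omega) (by omega) (by omega)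
      (by omega) (by omega)
    rintro rfl
    exact (hh ha).1 hya
  have hmin : ((G.branchAt x a).ncard ≤ (G.branchAt x b).ncard ∧
      (G.branchAt x a).ncard ≤ (G.branchAt x c).ncard) ∨
      ((G.branchAt x b).ncard ≤ (G.branchAt x a).ncard ∧
      (G.branchAt x b).ncard ≤ (G.branchAt x c).ncard) ∨
      ((G.branchAt x c).ncard ≤ (G.branchAt x a).ncard ∧
      (G.branchAt x c).ncard ≤ (G.branchAt x b).ncard) := by omega
  rcases hmin with h | h | h
  · exact key a b c y ha hb hc hab hac hbc hy hya h.1 h.2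
  · exact key b a c z hb ha hc hab.symm hbc hac hz hzb h.1 h.2
  · exact key c a b t hc ha hb hac.symm hbc.symm hab ht htc h.1 h.2

end IsLexMaximal

theorem IsAcyclic.mk_mem_edges_of_mem_branchAt (hG : G.IsAcyclic) {x a y : V} (ha : G.Adj x a)
    (hy : y ∈ G.branchAt x a) {w : G.Walk y x} (hw : w.IsTrail) : s(x, a) ∈ w.edges := by
  have := hG.left_notMem_branchAt ha
  rw [(hG.isCut_branchAt ha).mem_edges_iff w hw]
  tauto

theorem IsAcyclic.notMem_branchAt_of_isPath (hG : G.IsAcyclic) {x a y z : V} {w : G.Walk y z}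
    (hw : w.IsPath) (hx : x ∈ w.support) (ha : G.Adj x a) (hy : y ∈ G.branchAt x a) :
    z ∉ G.branchAt x a := by
  intro hz
  obtain ⟨p, q, rfl⟩ := Walk.mem_support_iff_exists_append.1 hx
  have hp := hG.mk_mem_edges_of_mem_branchAt ha hy hw.of_append_left.isTrail
  refine ((hG.isCut_branchAt ha).mem_edges_iff _ hw.isTrail).1 ?_ (by tauto)
  rw [Walk.edges_append, List.mem_append]
  exact .inl hp

theorem IsTree.exists_two_branchAt (hG : G.IsTree) {x y z : V} {w : G.Walk y z} (hw : w.IsPath)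
    (hx : x ∈ w.support) (hxy : x ≠ y) (hxz : x ≠ z) :
    ∃ a b, G.Adj x a ∧ G.Adj x b ∧ a ≠ b ∧ y ∈ G.branchAt x a ∧ z ∈ G.branchAt x b := by
  obtain ⟨a, ha, hya⟩ := hG.exists_mem_branchAt hxy
  obtain ⟨b, hb, hzb⟩ := hG.exists_mem_branchAt hxz
  refine ⟨a, b, ha, hb, ?_, hya, hzb⟩
  rintro rfl
  exact hG.isAcyclic.notMem_branchAt_of_isPath hw hx ha hya hzb

theorem Hangs.dist_add_dist_le (hG : G.Connected) {t x b : V} {S : Set V} (hS : G.Hangs t S)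
    (hx : x ∈ S) (hb : b ∉ S) : G.dist x t + G.dist t b ≤ G.dist x b := by
  obtain ⟨w, hw⟩ := hG.exists_walk_length_eq_dist x b
  have ht : t ∈ w.support := by
    by_contra ht
    exact hb (hS.mem_of_walk w hx ht)
  obtain ⟨p, q, rfl⟩ := Walk.mem_support_iff_exists_append.1 ht
  rw [← hw, Walk.length_append]
  exact add_le_add (dist_le p) (dist_le q)

theorem IsTree.mem_support_of_mem_support (hG : G.IsTree) {a b u v x : V} {w : G.Walk a b}
    {w' : G.Walk u v} (hw : w.IsPath) (hw' : w'.IsPath) (hu : u ∈ w.support)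
    (hv : v ∈ w.support) (hx : x ∈ w'.support) : x ∈ w.support := by
  obtain ⟨p, q, rfl⟩ := Walk.mem_support_iff_exists_append.1 hu
  rw [Walk.mem_support_append_iff] at hv ⊢
  rcases hv with hv | hv
  · obtain ⟨p₁, p₂, rfl⟩ := Walk.mem_support_iff_exists_append.1 hv
    have := hG.isAcyclic.eq_of_isPath hw.of_append_left.of_append_right hw'.reverse
    subst this
    rw [Walk.mem_support_append_iff]
    exact .inl (.inr (by simpa using hx))
  · obtain ⟨q₁, q₂, rfl⟩ := Walk.mem_support_iff_exists_append.1 hv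
    have := hG.isAcyclic.eq_of_isPath hw.of_append_right.of_append_left hw'
    subst this
    rw [Walk.mem_support_append_iff]
    exact .inr (.inl hx)

/-- The branch at an inner vertex of a pendant segment towards the leaf has no branch vertex. -/
theorem IsTree.not_isBranchV_of_mem_branchAt (hG : G.IsTree) {u v x s y : V} {w : G.Walk u v}
    (hw : w.IsPath) (hu : IsLeafV G u)
    (hd : ∀ x ∈ w.support, x ≠ u → x ≠ v → degN G x = 2) (hx : x ∈ w.support) (hxv : x ≠ v)
    (hs : G.Adj x s) (hus : u ∈ G.branchAt x s) (hy : y ∈ G.branchAt x s) : ¬ IsBranchV G y := by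
  have hxs := hG.isAcyclic.left_notMem_branchAt hs
  obtain ⟨p, q, rfl⟩ := Walk.mem_support_iff_exists_append.1 hx
  have hp := hw.of_append_left
  have hvp : v ∉ p.support := fun h =>
    hw.ne_of_mem_support_of_append hxv.symm h q.end_mem_support rfl
  have hd' : ∀ z ∈ p.support, z ≠ u → degN G z = 2 := fun z hz hzu =>
    hd z ((Walk.mem_support_append_iff _ _).2 (.inl hz)) hzu (fun h => hvp (h ▸ hz))
  have hxu : u ≠ x := fun h => hxs (h ▸ hus)
  have hnil : ¬ p.Nil := fun h => hxu h.eq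
  have hR : G.Hangs x {z | z ∈ p.support ∧ z ≠ x} := by
    refine ⟨fun h => h.2 rfl, fun a b hab ha hb => ?_⟩
    by_contra hbx
    refine hb ⟨?_, hbx⟩
    by_cases hau : a = u
    · subst hau
      obtain ⟨c, hc⟩ := Set.ncard_eq_one.1 hu
      have h1 : b ∈ G.neighborSet a := hab
      have h2 : p.snd ∈ G.neighborSet a := p.adj_snd hnil
      rw [hc, Set.mem_singleton_iff] at h1 h2
      rw [h1, ← h2]
      exact Walk.getVert_mem_support _ _
    · exact Walk.snd_mem_support_of_mem_edges _
        (hp.mk_mem_edges_of_degN_eq_two ha.1 hau ha.2 (hd' a ha.1 hau) hab)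
  have hyR := (hG.isAcyclic.isCut_branchAt hs).subset_hangs hG.connected hxs hus hR
    ⟨p.start_mem_support, hxu⟩ hy
  unfold IsLeafV at hu
  unfold IsBranchV
  by_cases hyu : y = u
  · rw [hyu]
    omega
  · have := hd' y hyR.1 hyu
    omega

theorem isPathGraph_induce {a b : V} {w : G.Walk a b} (hw : w.IsPath) {K : Set V}
    (hK : ∀ x, x ∈ w.support ↔ x ∈ K) : IsPathGraph (G.induce K) := by
  refine ⟨_, _, w.induce K fun x hx => (hK x).1 hx, ?_, ?_⟩
  · refine Walk.IsPath.of_map (f := (Embedding.induce K).toHom) ?_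
    rwa [Walk.map_induce]
  · rintro ⟨x, hx⟩
    rw [Walk.support_induce]
    simpa using (hK x).2 hx

namespace IsLexMaximal

variable [Fintype V] {k : ℕ}

theorem isQuasiCaterpillar (hG : G.IsLexMaximal k) (hk : 1 ≤ k) (hbr : ∃ x, IsBranchV G x) :
    IsQuasiCaterpillar G := by
  have htree := hG.1
  have hacyc := htree.isAcyclic
  obtain ⟨x₀, hx₀⟩ := hbr
  obtain ⟨⟨a, b⟩, ⟨ha, hb⟩, hmax⟩ := Set.exists_max_image
    {z : V × V | IsBranchV G z.1 ∧ IsBranchV G z.2} (fun z => G.dist z.1 z.2)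
    (Set.toFinite _) ⟨(x₀, x₀), hx₀, hx₀⟩
  obtain ⟨w, hw, -⟩ := htree.connected.exists_path_of_dist a b
  have hbranch : ∀ x, IsBranchV G x → x ∈ w.support := by
    intro x hx
    by_contra hxw
    obtain ⟨t, ht, hmin⟩ := Set.exists_min_image {t | t ∈ w.support} (fun t => G.dist x t)
      (Set.toFinite _) ⟨a, w.start_mem_support⟩
    obtain ⟨s, hts, hxs⟩ := htree.exists_mem_branchAt (p := t) (q := x) (fun h => hxw (h ▸ ht))
    have hsw : s ∉ w.support := by
      intro hsw
      classical
      obtain ⟨r, hr, hrl⟩ := htree.connected.exists_path_of_dist x t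
      have hsr := Walk.snd_mem_support_of_mem_edges _
        (hacyc.mk_mem_edges_of_mem_branchAt hts hxs hr.isTrail)
      have h1 := Walk.length_takeUntil_lt_length hsr hts.ne'
      have h2 := dist_le (r.takeUntil s hsr)
      have h3 := hmin s hsw
      omega
    have hdisj : ∀ y ∈ w.support, y ∉ G.branchAt t s := by
      intro y hy hys
      obtain ⟨r, hr, -⟩ := htree.connected.exists_path_of_dist y t
      exact hsw (htree.mem_support_of_mem_support hw hr hy ht (Walk.snd_mem_support_of_mem_edges _
        (hacyc.mk_mem_edges_of_mem_branchAt hts hys hr.isTrail)))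
    have hend : ∀ c, IsBranchV G c → c ∈ w.support → G.dist a b ≤ G.dist t c → False := by
      intro c hc hcw hle
      have h1 := Hangs.dist_add_dist_le htree.connected (hacyc.hangs_branchAt hts) hxs (hdisj c hcw)
      have h2 := hmax (x, c) ⟨hx, hc⟩
      have h3 := htree.connected.pos_dist_of_ne (u := x) (v := t) (fun h => hxw (h ▸ ht))
      simp only at h2
      omega
    by_cases hta : t = a
    · exact hend b hb w.end_mem_support (by rw [hta])
    by_cases htb : t = b
    · exact hend a ha w.start_mem_support (by rw [htb, dist_comm])
    obtain ⟨c, d, hc, hd, hcd, hac, hbd⟩ := htree.exists_two_branchAt hw ht hta htb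
    refine hG.not_three_branches hk hc hd hts hcd ?_ ?_ ha hac hb hbd hx hxs
    · rintro rfl
      exact hdisj a w.start_mem_support hac
    · rintro rfl
      exact hdisj b w.end_mem_support hbd
  refine ⟨htree, isPathGraph_induce hw fun x => ⟨fun hx => ?_, fun hx => ?_⟩⟩
  · rintro ⟨u, v, r, hseg, hu, hr, hd, hxr, hxb⟩
    have hxa : x ≠ a := fun h => hxb (h ▸ ha)
    have hxb' : x ≠ b := fun h => hxb (h ▸ hb)
    obtain ⟨c, d, hc, hd', hcd, hac, hbd⟩ := htree.exists_two_branchAt hw hx hxa hxb'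
    have h2 : 1 < degN G x := (Set.one_lt_ncard (Set.toFinite _)).2 ⟨c, hc, d, hd', hcd⟩
    have hx2 : degN G x = 2 := by
      unfold IsBranchV at hxb
      omega
    have hxu : x ≠ u := fun h => hseg.degN_left_ne (h ▸ hx2)
    have hxv : x ≠ v := fun h => hseg.degN_right_ne (h ▸ hx2)
    obtain ⟨s, hs, hus⟩ := htree.exists_mem_branchAt hxu
    rcases eq_or_eq_of_degN_eq_two hx2 hc hd' hcd hs with rfl | rfl
    · exact htree.not_isBranchV_of_mem_branchAt hr hu hd hxr hxv hs hus hac ha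
    · exact htree.not_isBranchV_of_mem_branchAt hr hu hd hxr hxv hs hus hbd hb
  · by_cases hxb : IsBranchV G x
    · exact hbranch x hxb
    obtain ⟨s, hs, -⟩ := htree.exists_mem_branchAt (p := x) (q := a) (fun h => hxb (h ▸ ha))
    obtain ⟨u, v, r, hr, hsr, hd, hu, hv⟩ := hacyc.exists_segment (e := s(x, s)) hs
    have hxr := Walk.fst_mem_support_of_mem_edges _ hsr
    obtain ⟨c, hc⟩ := Walk.adj_start_of_mem_edges hsr
    obtain ⟨d, hd'⟩ := Walk.adj_start_of_mem_edges (w := r.reverse) (e := s(x, s))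
      (by simpa using hsr)
    rw [degN_ne_two_iff hc] at hu
    rw [degN_ne_two_iff hd'] at hv
    have huv := hr.ne_of_mem_edges hsr
    have hdr : ∀ y ∈ r.reverse.support, y ≠ v → y ≠ u → degN G y = 2 :=
      fun y hy hyv hyu => hd y (by simpa using hy) hyu hyv
    have hul : ¬ IsLeafV G u := fun h =>
      hx ⟨u, v, r, ⟨huv, hu, hv, r, hr, hd⟩, h, hr, hd, hxr, hxb⟩
    have hvl : ¬ IsLeafV G v := fun h =>
      hx ⟨v, u, r.reverse, ⟨huv.symm, hv, hu, r.reverse, hr.reverse, hdr⟩, h, hr.reverse, hdr,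
        by simpa using hxr, hxb⟩
    exact htree.mem_support_of_mem_support hw hr (hbranch u (hu.resolve_left hul))
      (hbranch v (hv.resolve_left hvl)) hxr

theorem dist_le_or_dist_le (hG : G.IsLexMaximal k) (hk : 1 ≤ k) {u v x : V} {w : G.Walk u v}
    (hw : w.IsPath) (hbr : ∀ y, IsBranchV G y → y ∈ w.support) (hx : IsBranchV G x)
    (hx4 : degN G x = 4) : (∀ y, IsBranchV G y → G.dist u x ≤ G.dist u y) ∨
      ∀ y, IsBranchV G y → G.dist v x ≤ G.dist v y := by
  by_contra! h
  obtain ⟨⟨y, hy, hyx⟩, z, hz, hzx⟩ := h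
  have key : ∀ {u v : V} {p : G.Walk u x} {q : G.Walk x v} {y : V}, (p.append q).IsPath →
      y ∈ (p.append q).support → G.dist u y < G.dist u x →
      ∃ r₁ : G.Walk u y, ∃ r₂ : G.Walk y x, p = r₁.append r₂ := by
    intro u v p q y hw hy hlt
    rw [Walk.mem_support_append_iff] at hy
    rcases hy with hy | hy
    · exact Walk.mem_support_iff_exists_append.1 hy
    · obtain ⟨q₁, q₂, rfl⟩ := Walk.mem_support_iff_exists_append.1 hy
      rw [Walk.append_assoc] at hw
      rw [← hG.1.length_eq_dist hw.of_append_left,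
        ← hG.1.length_eq_dist hw.of_append_left.of_append_left, Walk.length_append] at hlt
      omega
  obtain ⟨p, q, rfl⟩ := Walk.mem_support_iff_exists_append.1 (hbr x hx)
  obtain ⟨r₁, r₂, rfl⟩ := key hw (hbr y hy) hyx
  have hrev := hw.reverse
  rw [Walk.reverse_append] at hrev
  obtain ⟨t₁, t₂, ht⟩ := key hrev
    (by rw [← Walk.reverse_append, Walk.support_reverse, List.mem_reverse]; exact hbr z hz) hzx
  obtain rfl : q = t₂.reverse.append t₁.reverse := by
    rw [← Walk.reverse_append, ← ht, Walk.reverse_reverse]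
  rw [Walk.append_assoc] at hw
  have hpath : (r₂.append t₂.reverse).IsPath := by
    rw [← Walk.append_assoc, ← Walk.append_assoc] at hw
    have := hw.of_append_right
    rw [Walk.append_assoc] at this
    exact this.of_append_left
  obtain ⟨a, b, ha, hb, hab, hya, hzb⟩ := hG.1.exists_two_branchAt (x := x) hpath
    (by rw [Walk.mem_support_append_iff]; exact .inl r₂.end_mem_support)
    (by rintro rfl; omega) (by rintro rfl; omega)
  exact hG.degN_ne_four hk ha hb hab hy hya hz hzb hx4

end IsLexMaximal

end Maximizers

theorem IsTree.exists_tree_fin {W : Type*} [Fintype W] {H : SimpleGraph W} (hH : H.IsTree) :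
    ∃ G : SimpleGraph (Fin ((segmentMultiset H).sum + 1)), G.IsTree ∧
      segmentMultiset G = segmentMultiset H ∧
      ∀ k, 1 ≤ k → steinerWiener G k = steinerWiener H k := by
  have f := Iso.map (Fintype.equivFinOfCardEq hH.sum_segmentMultiset.symm) H
  exact ⟨_, f.isTree_iff.1 hH, segmentMultiset_iso hH f, fun k hk => hH.steinerWiener_iso f hk⟩

end SimpleGraph

/-- For every `k ≥ 2` and every segment sequence `ℓ` (with `m ≥ 3` segments)
realized by some tree, there is a tree `T` with segment sequence `ℓ` maximizing the Steiner
`k`-Wiener index which is a quasi-caterpillar in which every branch vertex has degree 3 or 4,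
and every branch vertex of degree 4 is one of the two branch vertices closest to the two ends
of the backbone. -/
theorem exists_maximizer_quasiCaterpillar_degree_three_or_four (k m : ℕ)
    (hk : 2 ≤ k) (hm : 3 ≤ m) (ℓ : Multiset ℕ) (hcard : Multiset.card ℓ = m)
    (hex : ∃ (V : Type) (_ : Fintype V) (T0 : SimpleGraph V),
      T0.IsTree ∧ segmentMultiset T0 = ℓ) :
    ∃ T : SimpleGraph (Fin (ℓ.sum + 1)), T.IsTree ∧ segmentMultiset T = ℓ ∧
      (∀ (W : Type) [Fintype W] (H : SimpleGraph W), H.IsTree → segmentMultiset H = ℓ →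
        steinerWiener H k ≤ steinerWiener T k) ∧
      IsQuasiCaterpillar T ∧
      (∀ x, IsBranchV T x → degN T x = 3 ∨ degN T x = 4) ∧
      (∀ (u v : Fin (ℓ.sum + 1)) (w : T.Walk u v), IsBackbone T w →
        ∀ x, IsBranchV T x → degN T x = 4 →
          ((∀ y, IsBranchV T y → T.dist u x ≤ T.dist u y) ∨
           (∀ y, IsBranchV T y → T.dist v x ≤ T.dist v y))) := by
  obtain ⟨V, _, T₀, hT₀, rfl⟩ := hex
  obtain ⟨G₀, hG₀, hG₀seg, -⟩ := hT₀.exists_tree_fin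
  obtain ⟨T, ⟨hT, hTseg⟩, hmax⟩ := Set.exists_max_image
    {G : SimpleGraph (Fin ((segmentMultiset T₀).sum + 1)) |
      G.IsTree ∧ segmentMultiset G = segmentMultiset T₀}
    (fun G => toLex (steinerWiener G k, steinerWiener G 2)) (Set.toFinite _) ⟨G₀, hG₀, hG₀seg⟩
  have hlex : T.IsLexMaximal k := by
    refine ⟨hT, fun G hG hGseg hle => ?_⟩
    have h := hmax G ⟨hG, hGseg.trans hTseg⟩
    rw [Prod.Lex.toLex_le_toLex] at h
    rcases h with h | h
    · exact absurd h hle.not_gt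
    · exact h.2
  have hk1 : 1 ≤ k := by omega
  refine ⟨T, hT, hTseg, ?_, ?_, ?_, ?_⟩
  · intro W _ H hH hHseg
    have h := hH.exists_tree_fin
    rw [hHseg] at h
    obtain ⟨G, hG, hGseg, hSW⟩ := h
    rw [← hSW k hk1]
    have h := hmax G ⟨hG, hGseg⟩
    rw [Prod.Lex.toLex_le_toLex] at h
    exact h.elim le_of_lt fun h => h.1.le
  · refine hlex.isQuasiCaterpillar hk1 (hT.exists_isBranchV ?_)
    rw [hTseg, hcard]
    omega
  · intro x hx
    have := hlex.degN_le_four hk1 x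
    unfold IsBranchV at hx
    omega
  · intro u v w hw x hx hx4
    exact hlex.dist_le_or_dist_le hk1 hw.1 hw.2.1 hx hx4
end
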